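/- Let k ≥ 1, n ≥ 0 and 1 ≤ r ≤ 2^n be integers, set j = 2^n + r and d = 2^{n+k−1} + r. Then for any masses μ_1,…,μ_j on ℝ^d there exists an arrangement of k affine hyperplanes in ℝ^d that equiparts every μ_i. -/

import Mathlib

open MeasureTheory

/-- A mass on `ℝ^d`: a finite Borel measure vanishing on every affine hyperplane
(the zero set of an affine map with nonzero linear part). -/
def IsMass {d : ℕ} (μ : Measure (Fin d → ℝ)) : Prop :=
  IsFiniteMeasure μ ∧
    ∀ f : (Fin d → ℝ) →ᵃ[ℝ] ℝ, f.linear ≠ 0 → μ {x | f x = 0} = 0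

/-- The arrangement of `k` affine hyperplanes given by the affine maps `f t`
equiparts `μ`: every open orthant carries measure `μ(ℝ^d) / 2 ^ k`. -/
def Equiparts {d k : ℕ} (f : Fin k → ((Fin d → ℝ) →ᵃ[ℝ] ℝ))
    (μ : Measure (Fin d → ℝ)) : Prop :=
  ∀ ε : Fin k → Bool,
    μ {x | ∀ t, if ε t then 0 < f t x else f t x < 0} = μ Set.univ / 2 ^ k

namespace GHR

section Cochain
variable {V : Type*}

def skip (m : ℕ) (v : ℕ → V) : ℕ → V := fun i => if i < m then v i else v (i + 1)
def shift (n : ℕ) (v : ℕ → V) : ℕ → V := fun i => v (n + i)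
def dl (n : ℕ) (c : (ℕ → V) → ZMod 2) : (ℕ → V) → ZMod 2 :=
  fun v => ∑ m ∈ Finset.range (n + 2), c (skip m v)
def cup (n : ℕ) (c c' : (ℕ → V) → ZMod 2) : (ℕ → V) → ZMod 2 :=
  fun v => c v * c' (shift n v)
def Dep (n : ℕ) (c : (ℕ → V) → ZMod 2) : Prop :=
  ∀ v w : ℕ → V, (∀ i ≤ n, v i = w i) → c v = c w

theorem two_cancel (a b : ZMod 2) : a + b + (b) = a := by
  rw [add_assoc, CharTwo.add_self_eq_zero, add_zero]

theorem leibniz (n m : ℕ) (c c' : (ℕ → V) → ZMod 2) (hc : Dep n c) :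
    dl (n + m) (cup n c c') = cup (n + 1) (dl n c) c' + cup n c (dl m c') := by
  funext v
  simp only [dl, cup, Pi.add_apply]
  have e1 : ∀ i ≤ n, shift n (skip i v) = shift (n + 1) v := by
    intro i hi; funext j
    simp only [shift, skip]
    rw [if_neg (by omega)]; congr 1; omega
  have e2 : ∀ i, c (skip (n + 1 + i) v) = c v := by
    intro i
    apply hc
    intro j hj
    simp only [skip]
    rw [if_pos (by omega)]
  have e3 : ∀ i, shift n (skip (n + i) v) = skip i (shift n v) := by
    intro i; funext j
    simp only [shift, skip]
    by_cases h : j < i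
    · rw [if_pos (by omega), if_pos h]
    · rw [if_neg (by omega), if_neg h]; rfl
  have e4 : skip 0 (shift n v) = shift (n + 1) v := by
    funext j; simp only [shift, skip]; rw [if_neg (by omega)]; congr 1; omega
  rw [show n + m + 2 = (n + 1) + (m + 1) by ring, Finset.sum_range_add,
    show n + 2 = (n + 1) + 1 by ring, Finset.sum_range_succ (fun i => c (skip i v)),
    Finset.sum_range_succ' (fun i => c' (skip i (shift n v))), e4, add_mul, mul_add,
    Finset.sum_mul, Finset.mul_sum]
  have h1 : ∑ x ∈ Finset.range (n + 1), c (skip x v) * c' (shift n (skip x v)) =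
      ∑ x ∈ Finset.range (n + 1), c (skip x v) * c' (shift (n + 1) v) := by
    apply Finset.sum_congr rfl
    intro x hx
    rw [e1 x (by have := Finset.mem_range.1 hx; omega)]
  have h2 : ∑ x ∈ Finset.range (m + 1), c (skip (n + 1 + x) v) * c' (shift n (skip (n + 1 + x) v)) =
      ∑ x ∈ Finset.range (m + 1), c v * c' (skip (x + 1) (shift n v)) := by
    apply Finset.sum_congr rfl
    intro x hx
    rw [e2, show n + 1 + x = n + (x + 1) by ring, e3]
  rw [h1, h2]
  have := e2 0
  rw [add_zero] at this
  rw [this]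
  generalize c v * c' (shift (n + 1) v) = y
  have : y + y = 0 := CharTwo.add_self_eq_zero y
  linear_combination (-1 : ZMod 2) * this

theorem dl_add (n : ℕ) (c c' : (ℕ → V) → ZMod 2) : dl n (c + c') = dl n c + dl n c' := by
  funext v; simp [dl, Finset.sum_add_distrib]

theorem cup_zero_right (n : ℕ) (c : (ℕ → V) → ZMod 2) : cup n c 0 = 0 := by
  funext v; simp [cup]
theorem cup_zero_left (n : ℕ) (c : (ℕ → V) → ZMod 2) : cup n 0 c = 0 := by
  funext v; simp [cup]

theorem Dep.cup {n m : ℕ} {c c' : (ℕ → V) → ZMod 2} (h : Dep n c) (h' : Dep m c') :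
    Dep (n + m) (cup n c c') := by
  intro v w hvw
  simp only [GHR.cup]
  rw [h v w (fun i hi => hvw i (by omega)),
    h' (shift n v) (shift n w) (fun i hi => hvw _ (by omega))]

theorem Dep.add {n : ℕ} {c c' : (ℕ → V) → ZMod 2} (h : Dep n c) (h' : Dep n c') :
    Dep n (c + c') := by
  intro v w hvw
  simp only [Pi.add_apply]
  rw [h v w hvw, h' v w hvw]

variable {Γ : Type*} [Group Γ] [MulAction Γ V]

def Inv (Γ : Type*) [Group Γ] [MulAction Γ V] (c : (ℕ → V) → ZMod 2) : Prop :=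
  ∀ (g : Γ) (v : ℕ → V), c (fun i => g • v i) = c v

theorem Inv.cup {n : ℕ} {c c' : (ℕ → V) → ZMod 2} (h : Inv Γ c) (h' : Inv Γ c') :
    Inv Γ (cup n c c') := by
  intro g v
  have := h' g (shift n v)
  simp only [GHR.cup]
  rw [h g v, ← this]; rfl

theorem Inv.add {c c' : (ℕ → V) → ZMod 2} (h : Inv Γ c) (h' : Inv Γ c') :
    Inv Γ (c + c') := by
  intro g v
  simp only [Pi.add_apply]
  rw [h g v, h' g v]

/-- cocycles `c`, `c'` of degree `n+1` that are cohomologous -/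
structure Coh (Γ : Type*) [Group Γ] [MulAction Γ V] (n : ℕ) (c c' : (ℕ → V) → ZMod 2) : Prop where
  dep : Dep (n + 1) c
  dep' : Dep (n + 1) c'
  cl : dl (n + 1) c = 0
  cl' : dl (n + 1) c' = 0
  inv : Inv Γ c
  inv' : Inv Γ c'
  bd : ∃ b, Dep n b ∧ Inv Γ b ∧ c + c' = dl n b

theorem Coh.cup {n m : ℕ} {c c' d d' : (ℕ → V) → ZMod 2} (h : Coh Γ n c c') (h' : Coh Γ m d d') :
    Coh Γ (n + 1 + m) (cup (n + 1) c d) (cup (n + 1) c' d') := by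
  obtain ⟨b, hb1, hb2, hb3⟩ := h.bd
  obtain ⟨b', hb1', hb2', hb3'⟩ := h'.bd
  refine ⟨?_, ?_, ?_, ?_, h.inv.cup h'.inv, h.inv'.cup h'.inv', GHR.cup n b d + GHR.cup (n + 1) c' b', ?_, ?_, ?_⟩
  · exact h.dep.cup h'.dep
  · exact h.dep'.cup h'.dep'
  · rw [show n + 1 + m + 1 = (n + 1) + (m + 1) by ring, leibniz _ _ _ _ h.dep, h.cl, h'.cl,
      cup_zero_left, cup_zero_right, add_zero]
  · rw [show n + 1 + m + 1 = (n + 1) + (m + 1) by ring, leibniz _ _ _ _ h.dep', h.cl', h'.cl',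
      cup_zero_left, cup_zero_right, add_zero]
  · apply Dep.add
    · have := hb1.cup h'.dep
      rwa [show n + 1 + m = n + (m + 1) by ring]
    · exact h.dep'.cup hb1'
  · exact (hb2.cup h'.inv).add (h.inv'.cup hb2')
  · rw [dl_add, leibniz _ _ _ _ h.dep', h.cl', cup_zero_left, zero_add, ← hb3',
      show n + 1 + m = n + (m + 1) by ring, leibniz _ _ _ _ hb1, h'.cl, cup_zero_right, add_zero,
      ← hb3]
    funext v
    simp only [GHR.cup, Pi.add_apply]
    generalize d (shift (n + 1) v) = y
    generalize d' (shift (n + 1) v) = y'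
    generalize c v = x
    generalize c' v = x'
    revert x x' y y'; decide

/-- the coboundary of a vertex function -/
def dd (s : V → ZMod 2) : (ℕ → V) → ZMod 2 := fun v => s (v 0) + s (v 1)

theorem dd_dep (s : V → ZMod 2) : Dep 1 (dd s) := by
  intro v w h
  simp [dd, h 0, h 1]

theorem dd_cl (s : V → ZMod 2) : dl 1 (dd s) = 0 := by
  funext v
  simp [dl, dd, skip, Finset.sum_range_succ]
  generalize s (v 0) = x
  generalize s (v 1) = y
  generalize s (v 2) = z
  revert x y z; decide

theorem dd_eq (s : V → ZMod 2) : dd s = dl 0 (fun v => s (v 0)) := by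
  funext v
  simp [dl, dd, skip, Finset.sum_range_succ, add_comm]

theorem Coh_dd (s t : V → ZMod 2) (χ : Γ → ZMod 2) (hs : ∀ (g : Γ) v, s (g • v) = s v + χ g)
    (ht : ∀ (g : Γ) v, t (g • v) = t v + χ g) : Coh Γ 0 (dd s) (dd t) := by
  have key : ∀ x y z : ZMod 2, x + z + (y + z) = x + y := by decide
  refine ⟨dd_dep s, dd_dep t, dd_cl s, dd_cl t, ?_, ?_, fun v => s (v 0) + t (v 0), ?_, ?_, ?_⟩
  · intro g v; simp only [dd, hs, key]
  · intro g v; simp only [dd, ht, key]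
  · intro v w h; simp [h 0]
  · intro g v; simp only [hs, ht, key]
  · rw [dd_eq, dd_eq, ← dl_add]; rfl

/-- symmetrised product of two degree one cocycles -/
def ee (s0 s1 s2 : V → ZMod 2) : (ℕ → V) → ZMod 2 := fun v =>
  (s1 (v 0) + s1 (v 1)) * (s2 (v 1) + s2 (v 2)) +
  (s0 (v 0) + s0 (v 1)) * ((s1 (v 1) + s1 (v 2)) * (s2 (v 1) + s2 (v 2))) +
  s0 (v 0) * ((s1 (v 0) + s1 (v 1)) * (s2 (v 1) + s2 (v 2)) +
    (s2 (v 0) + s2 (v 1)) * (s1 (v 1) + s1 (v 2)))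

theorem ee_eq (s0 s1 s2 : V → ZMod 2) : ee s0 s1 s2 = cup 1 (dd s1) (dd s2) +
    dl 1 (fun v => s0 (v 0) * ((s1 (v 0) + s1 (v 1)) * (s2 (v 0) + s2 (v 1)))) := by
  funext v
  simp [dl, dd, skip, ee, cup, shift, Finset.sum_range_succ]
  generalize s0 (v 0) = x0
  generalize s0 (v 1) = y0
  generalize s1 (v 0) = x1
  generalize s1 (v 1) = y1
  generalize s1 (v 2) = z1
  generalize s2 (v 0) = x2
  generalize s2 (v 1) = y2
  generalize s2 (v 2) = z2
  revert x0 y0 x1 y1 z1 x2 y2 z2; decide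

theorem dl_dl1 (c : (ℕ → V) → ZMod 2) : dl 2 (dl 1 c) = 0 := by
  funext v
  simp only [dl, Finset.sum_range_succ, Finset.range_zero, Finset.sum_empty, zero_add]
  have e : ∀ i j, i ≤ j → skip i (skip (j+1) v) = skip j (skip i v) := by
    intro i j hij
    funext l
    simp only [skip]
    split_ifs <;> first | rfl | omega
  rw [e 0 0 le_rfl, e 0 1 (by omega), e 0 2 (by omega), e 1 1 (by omega), e 1 2 (by omega),
    e 2 2 (by omega)]
  rw [Pi.zero_apply]
  generalize c _ = a1
  generalize c _ = a2
  generalize c _ = a3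
  generalize c _ = a4
  generalize c _ = a5
  generalize c _ = a6
  revert a1 a2 a3 a4 a5 a6; decide

theorem Coh_ee (s0 s1 s2 t1 t2 : V → ZMod 2) (χ1 χ2 : Γ → ZMod 2)
    (h0 : ∀ (g : Γ) v, s0 (g • v) = s0 v)
    (h1 : ∀ (g : Γ) v, s1 (g • v) = s1 v + χ1 g) (h2 : ∀ (g : Γ) v, s2 (g • v) = s2 v + χ2 g)
    (ht1 : ∀ (g : Γ) v, t1 (g • v) = t1 v + χ1 g) (ht2 : ∀ (g : Γ) v, t2 (g • v) = t2 v + χ2 g) :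
    Coh Γ 1 (ee s0 s1 s2) (cup 1 (dd t1) (dd t2)) := by
  have key : ∀ x y z : ZMod 2, x + z + (y + z) = x + y := by decide
  have H := (Coh_dd s1 t1 χ1 h1 ht1).cup (Coh_dd s2 t2 χ2 h2 ht2)
  simp only [zero_add, add_zero] at H
  obtain ⟨b, hb1, hb2, hb3⟩ := H.bd
  refine ⟨?_, H.dep', ?_, H.cl', ?_, H.inv',
    b + (fun v => s0 (v 0) * ((s1 (v 0) + s1 (v 1)) * (s2 (v 0) + s2 (v 1)))), ?_, ?_, ?_⟩
  · intro v w h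
    simp [ee, h 0, h 1, h 2]
  · rw [ee_eq, dl_add, H.cl, dl_dl1, add_zero]
  · intro g v
    simp only [ee, h0, h1, h2, key]
  · apply hb1.add
    intro v w h; simp [h 0, h 1]
  · apply hb2.add
    intro g v
    simp only [h0, h1, h2, key]
  · rw [ee_eq, dl_add, ← hb3]; abel

end Cochain

end GHR

namespace GHR

section Grid
variable {k N : ℕ}

/-- Grid points of the product of the boundaries of cubes `[-L,L]^(δ i + 1)`. -/
def Valid (δ : Fin k → ℕ) (L : ℤ) (v : Fin k × Fin N → ℤ) : Prop :=
  ∀ i, (∀ a, |v (i, a)| ≤ L) ∧ (∃ a, |v (i, a)| = L) ∧ ∀ a : Fin N, δ i < a → v (i, a) = 0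

def Step (v w : Fin k × Fin N → ℤ) : Prop :=
  ∃ p ε, (ε = 1 ∨ ε = -1) ∧ Even (v p) ∧ w = Function.update v p (v p + ε)

def oddset (v : Fin k × Fin N → ℤ) : Finset (Fin k × Fin N) := Finset.univ.filter (fun p => Odd (v p))

theorem Step.card {v w : Fin k × Fin N → ℤ} (h : Step v w) :
    (oddset w).card = (oddset v).card + 1 := by
  obtain ⟨p, ε, hε, hp, rfl⟩ := h
  have : oddset (Function.update v p (v p + ε)) = insert p (oddset v) := by
    ext q
    simp only [oddset, Finset.mem_filter, Finset.mem_univ, true_and, Finset.mem_insert]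
    by_cases hq : q = p
    · subst hq
      simp only [Function.update_self, true_or, iff_true]
      rcases hε with rfl | rfl
      · exact hp.add_one
      · exact hp.add_odd (by decide)
    · simp [Function.update_of_ne hq, hq]
  rw [this, Finset.card_insert_of_notMem]
  simp [oddset, hp]

theorem Step.ne {v w : Fin k × Fin N → ℤ} (h : Step v w) : v ≠ w := by
  rintro rfl
  have := h.card
  omega

theorem mid_lemma (δ : Fin k → ℕ) {L : ℤ} (hL : Even L) {u x w : Fin k × Fin N → ℤ}
    (hu : Valid δ L u) (hw : Valid δ L w) (h1 : Step u x) (h2 : Step x w) :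
    ∃ x', x' ≠ x ∧ Valid δ L x' ∧ Step u x' ∧ Step x' w ∧
      ∀ y, Step u y → Step y w → y = x ∨ y = x' := by
  obtain ⟨p, ε, hε, hp, rfl⟩ := h1
  obtain ⟨q, η, hη, hq, rfl⟩ := h2
  have hε2 : ε ≠ 0 := by rcases hε with rfl | rfl <;> decide
  have hη2 : η ≠ 0 := by rcases hη with rfl | rfl <;> decide
  have hpq : q ≠ p := by
    rintro rfl
    simp only [Function.update_self] at hq
    rcases hε with rfl | rfl
    · have := hp.add_one
      rw [← Int.not_even_iff_odd] at this; exact this hq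
    · have := hp.add_odd (b := -1) (by decide)
      rw [← Int.not_even_iff_odd] at this; exact this hq
  rw [Function.update_of_ne hpq] at hq
  rw [Function.update_of_ne hpq] at hw ⊢
  have hup : Function.update u q (u q + η) ≠ Function.update u p (u p + ε) := by
    intro h
    have := congrFun h q
    rw [Function.update_self, Function.update_of_ne hpq] at this
    omega
  refine ⟨Function.update u q (u q + η), hup, ?_, ⟨q, η, hη, hq, rfl⟩, ⟨p, ε, hε, ?_, ?_⟩, ?_⟩
  · intro i
    have hui := hu i
    have hwi := hw i
    refine ⟨?_, ?_, ?_⟩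
    · intro a
      by_cases ha : (i, a) = q
      · have := hwi.1 a
        rw [ha] at this ⊢
        rwa [Function.update_self] at this ⊢
      · rw [Function.update_of_ne ha]; exact hui.1 a
    · obtain ⟨a, ha⟩ := hwi.2.1
      refine ⟨a, ?_⟩
      by_cases haq : (i, a) = q
      · rw [haq] at ha ⊢
        rwa [Function.update_self] at ha ⊢
      · rw [Function.update_of_ne haq] at ha ⊢
        by_cases hap : (i, a) = p
        · exfalso
          rw [hap, Function.update_self] at ha
          have h1 : Even (|u p + ε|) := ha ▸ hL
          rw [even_abs, Int.even_add] at h1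
          have := h1.1 hp
          rcases hε with rfl | rfl <;> revert this <;> decide
        · rwa [Function.update_of_ne hap] at ha
    · intro a ha
      have := hwi.2.2 a ha
      by_cases haq : (i, a) = q
      · rw [haq] at this ⊢
        rwa [Function.update_self] at this ⊢
      · rw [Function.update_of_ne haq]; exact hui.2.2 a ha
  · rw [Function.update_of_ne hpq.symm]; exact hp
  · rw [Function.update_of_ne hpq.symm, Function.update_comm hpq]
  · rintro y ⟨p', ε', hε', hp', rfl⟩ ⟨q', η', hη', hq', hy⟩
    have hpq' : q' ≠ p' := by
      rintro rfl
      simp only [Function.update_self] at hq'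
      rcases hε' with rfl | rfl
      · have := hp'.add_one
        rw [← Int.not_even_iff_odd] at this; exact this hq'
      · have := hp'.add_odd (b := -1) (by decide)
        rw [← Int.not_even_iff_odd] at this; exact this hq'
    rw [Function.update_of_ne hpq'] at hy
    have hε2' : ε' ≠ 0 := by rcases hε' with rfl | rfl <;> decide
    have e := congrFun hy p'
    rw [Function.update_of_ne hpq'.symm, Function.update_self] at e
    by_cases c1 : p' = q
    · subst c1
      rw [Function.update_self] at e
      right; rw [e]
    · by_cases c2 : p' = p
      · subst c2
        rw [Function.update_of_ne c1, Function.update_self] at e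
        left; rw [e]
      · rw [Function.update_of_ne c1, Function.update_of_ne c2] at e
        omega

theorem bot_lemma (δ : Fin k → ℕ) {L : ℤ} (hL : Even L) {x w : Fin k × Fin N → ℤ}
    (hx : Valid δ L x) (hw : Valid δ L w) (h0 : ∀ p, Even (x p)) (h2 : Step x w) :
    ∃ x', x' ≠ x ∧ Valid δ L x' ∧ (∀ p, Even (x' p)) ∧ Step x' w ∧
      ∀ y, (∀ p, Even (y p)) → Step y w → y = x ∨ y = x' := by
  obtain ⟨p, ε, hε, hp, rfl⟩ := h2
  have hε2 : ε ≠ 0 := by rcases hε with rfl | rfl <;> decide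
  have hodd : Odd (x p + ε) := by
    rcases hε with rfl | rfl
    · exact hp.add_one
    · exact hp.add_odd (by decide)
  refine ⟨Function.update x p (x p + 2 * ε), ?_, ?_, ?_, ⟨p, -ε, ?_, ?_, ?_⟩, ?_⟩
  · intro h
    have := congrFun h p
    rw [Function.update_self] at this
    omega
  · intro i
    have hxi := hx i
    have hwi := hw i
    refine ⟨?_, ?_, ?_⟩
    · intro a
      by_cases ha : (i, a) = p
      · have := hwi.1 a
        rw [ha] at this ⊢
        rw [Function.update_self] at this ⊢
        rw [abs_le] at this ⊢
        obtain ⟨l, hl⟩ := hL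
        obtain ⟨m, hm⟩ := hodd
        rcases hε with rfl | rfl <;> constructor <;> omega
      · rw [Function.update_of_ne ha]; exact hxi.1 a
    · obtain ⟨a, ha⟩ := hwi.2.1
      refine ⟨a, ?_⟩
      by_cases haq : (i, a) = p
      · exfalso
        rw [haq, Function.update_self] at ha
        have h1 : Even (|x p + ε|) := ha ▸ hL
        rw [even_abs] at h1
        rw [← Int.not_even_iff_odd] at hodd
        exact hodd h1
      · rw [Function.update_of_ne haq] at ha ⊢
        exact ha
    · intro a ha
      have := hwi.2.2 a ha
      by_cases haq : (i, a) = p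
      · rw [haq] at this
        rw [Function.update_self] at this
        rw [this] at hodd
        exact absurd hodd (by decide)
      · rw [Function.update_of_ne haq]; exact hxi.2.2 a ha
  · intro q
    by_cases hq : q = p
    · subst hq; rw [Function.update_self]; exact hp.add (even_two_mul ε)
    · rw [Function.update_of_ne hq]; exact h0 q
  · rcases hε with rfl | rfl <;> simp
  · rw [Function.update_self]; exact hp.add (even_two_mul ε)
  · rw [Function.update_self, Function.update_idem]; congr 1; ring
  · rintro y hy ⟨p', ε', hε', hp', he⟩
    have hpp : p' = p := by
      by_contra hne
      have := congrFun he p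
      rw [Function.update_self, Function.update_of_ne (Ne.symm hne)] at this
      have h1 := hy p
      rw [← this] at h1
      rw [← Int.not_even_iff_odd] at hodd
      exact hodd h1
    subst hpp
    have h1 := congrFun he p'
    rw [Function.update_self, Function.update_self] at h1
    have h3 : ∀ q, q ≠ p' → y q = x q := by
      intro q hq
      have := congrFun he q
      rw [Function.update_of_ne hq, Function.update_of_ne hq] at this
      exact this.symm
    by_cases hc : ε' = ε
    · left
      funext q
      by_cases hq : q = p'
      · subst hq; omega
      · exact h3 q hq
    · right
      funext q
      by_cases hq : q = p'
      · subst hq; rw [Function.update_self]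
        rcases hε with rfl | rfl <;> rcases hε' with rfl | rfl <;> omega
      · rw [Function.update_of_ne hq]; exact h3 q hq

/-- In a valid point with the maximal number of odd coordinates, each block has just one
active even coordinate. -/
theorem uniq_even (δ : Fin k → ℕ) (hδ : ∀ i, δ i < N) {L : ℤ} (hL : Even L)
    {x : Fin k × Fin N → ℤ}
    (hx : Valid δ L x) (hc : (oddset x).card = ∑ i, δ i) (i : Fin k) (a b : Fin N)
    (ha : (a : ℕ) ≤ δ i) (hb : (b : ℕ) ≤ δ i) (hae : Even (x (i, a))) (hbe : Even (x (i, b))) :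
    a = b := by
  classical
  by_contra hab
  let O : Fin k → Finset (Fin N) := fun j => Finset.univ.filter (fun c => Odd (x (j, c)))
  let A : Fin k → Finset (Fin N) := fun j => Finset.univ.filter (fun c => (c : ℕ) ≤ δ j)
  have hA : ∀ j, (A j).card = δ j + 1 := by
    intro j
    have : A j = Finset.Iic (⟨δ j, hδ j⟩ : Fin N) := by
      ext c; simp [A, Fin.le_def]
    rw [this, Fin.card_Iic]
  have hsum : (oddset x).card = ∑ j, (O j).card := by
    rw [oddset, Finset.card_filter, Fintype.sum_prod_type]
    apply Finset.sum_congr rfl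
    intro j _
    rw [Finset.card_filter]
  have hsub : ∀ j, O j ⊆ A j := by
    intro j c hc
    simp only [O, A, Finset.mem_filter, Finset.mem_univ, true_and] at hc ⊢
    by_contra hlt
    rw [(hx j).2.2 c (by omega)] at hc
    revert hc; decide
  have hle : ∀ j, (O j).card ≤ δ j := by
    intro j
    obtain ⟨c, hc⟩ := (hx j).2.1
    have hce : Even (x (j, c)) := by rw [← even_abs, hc]; exact hL
    by_cases hcA : c ∈ A j
    · have : O j ⊂ A j := by
        refine Finset.ssubset_iff_subset_ne.2 ⟨hsub j, ?_⟩
        intro he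
        rw [← he] at hcA
        simp only [O, Finset.mem_filter, Finset.mem_univ, true_and] at hcA
        rw [← Int.not_even_iff_odd] at hcA
        exact hcA hce
      have := Finset.card_lt_card this
      rw [hA] at this; omega
    · have h0 : x (j, c) = 0 := (hx j).2.2 c (by simpa [A] using hcA)
      have hO : O j = ∅ := by
        rw [h0] at hc
        simp only [abs_zero] at hc
        ext d
        simp only [O, Finset.mem_filter, Finset.mem_univ, true_and, Finset.notMem_empty, iff_false]
        have := (hx j).1 d
        rw [← hc, abs_nonpos_iff] at this
        rw [this]; decide
      rw [hO]; simp
  have hlt : (O i).card < δ i := by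
    have : O i ⊆ ((A i).erase a).erase b := by
      intro c hc
      simp only [Finset.mem_erase]
      refine ⟨?_, ?_, hsub i hc⟩
      · rintro rfl
        simp only [O, Finset.mem_filter, Finset.mem_univ, true_and] at hc
        rw [← Int.not_even_iff_odd] at hc
        exact hc hbe
      · rintro rfl
        simp only [O, Finset.mem_filter, Finset.mem_univ, true_and] at hc
        rw [← Int.not_even_iff_odd] at hc
        exact hc hae
    have h2 := Finset.card_le_card this
    rw [Finset.card_erase_of_mem, Finset.card_erase_of_mem, hA] at h2
    · have : δ i ≠ 0 := by
        intro h0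
        apply hab
        ext; omega
      omega
    · simp [A, ha]
    · simp only [Finset.mem_erase]
      exact ⟨fun h => hab h.symm, by simp [A, hb]⟩
  have : ∑ j, (O j).card < ∑ j, δ j :=
    Finset.sum_lt_sum (fun j _ => hle j) ⟨i, Finset.mem_univ _, hlt⟩
  omega

theorem top_lemma (δ : Fin k → ℕ) (hδ : ∀ i, δ i < N) {L : ℤ} (hL : Even L) (hLp : 0 < L)
    {u x : Fin k × Fin N → ℤ}
    (hu : Valid δ L u) (hx : Valid δ L x) (hc : (oddset u).card + 1 = ∑ i, δ i) (h1 : Step u x) :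
    ∃ x', x' ≠ x ∧ Valid δ L x' ∧ Step u x' ∧
      ∀ y, Valid δ L y → Step u y → y = x ∨ y = x' := by
  have act : ∀ z : Fin k × Fin N → ℤ, Valid δ L z → ∀ i a, z (i, a) ≠ 0 → (a : ℕ) ≤ δ i := by
    intro z hz i a h
    by_contra hlt
    exact h ((hz i).2.2 a (by omega))
  have hcx : (oddset x).card = ∑ i, δ i := by rw [h1.card, hc]
  obtain ⟨p, ε, hε, hp, rfl⟩ := h1
  have hodd : ∀ (q : Fin k × Fin N) (η : ℤ), (η = 1 ∨ η = -1) → Even (u q) → Odd (u q + η) := by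
    intro q η hη hq
    rcases hη with rfl | rfl
    · exact hq.add_one
    · exact hq.add_odd (by decide)
  have hne0 : ∀ z : ℤ, Odd z → z ≠ 0 := by rintro z hz rfl; revert hz; decide
  obtain ⟨i, a⟩ := p
  have haA : (a : ℕ) ≤ δ i := act _ hx i a (by
    rw [Function.update_self]; exact hne0 _ (hodd _ _ hε hp))
  obtain ⟨b, hb⟩ := (hx i).2.1
  have hba : b ≠ a := by
    rintro rfl
    rw [Function.update_self] at hb
    have h2 := hodd _ _ hε hp
    rw [← Int.not_even_iff_odd, ← even_abs, hb] at h2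
    exact h2 hL
  have hba' : (i, b) ≠ (i, a) := by simpa using hba
  rw [Function.update_of_ne hba'] at hb
  have hbA : (b : ℕ) ≤ δ i := act _ hu i b (by
    intro h; rw [h] at hb; simp at hb; omega)
  have hbe : Even (u (i, b)) := by rw [← even_abs, hb]; exact hL
  -- possible positions
  have pos : ∀ y, Valid δ L y → ∀ q η, (η = 1 ∨ η = -1) → Even (u q) →
      y = Function.update u q (u q + η) → q = (i, a) ∨ q = (i, b) := by
    rintro y hy ⟨i', a'⟩ η hη hq rfl
    have ha'A : (a' : ℕ) ≤ δ i' := act _ hy i' a' (by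
      rw [Function.update_self]; exact hne0 _ (hodd _ _ hη hq))
    by_cases hi : i' = i
    · subst hi
      by_cases haa : a' = a
      · left; rw [haa]
      · right
        have := uniq_even δ hδ hL hx hcx i' a' b ha'A hbA
          (by rw [Function.update_of_ne (by simpa using haa)]; exact hq)
          (by rw [Function.update_of_ne hba']; exact hbe)
        rw [this]
    · exfalso
      obtain ⟨c, hc'⟩ := (hy i').2.1
      have hca : c ≠ a' := by
        rintro rfl
        rw [Function.update_self] at hc'
        have h2 := hodd _ _ hη hq
        rw [← Int.not_even_iff_odd, ← even_abs, hc'] at h2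
        exact h2 hL
      rw [Function.update_of_ne (by simpa using hca)] at hc'
      have hcA : (c : ℕ) ≤ δ i' := act _ hu i' c (by
        intro h; rw [h] at hc'; simp at hc'; omega)
      exact hca (uniq_even δ hδ hL hx hcx i' c a' hcA ha'A
          (by rw [Function.update_of_ne (by simp [hi]), ← even_abs, hc']; exact hL)
          (by rw [Function.update_of_ne (by simp [hi])]; exact hq))
  have hux : ∀ (q : Fin k × Fin N) (η : ℤ), q.1 = i → (q.2 : ℕ) ≤ δ i → |u q + η| ≤ L →
      (∃ c, (i, c) ≠ q ∧ |u (i, c)| = L) → Valid δ L (Function.update u q (u q + η)) := by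
    rintro ⟨q1, q2⟩ η hq1 hq2 hle ⟨c, hc1, hc2⟩ j
    simp only at hq1 hq2
    subst hq1
    refine ⟨?_, ?_, ?_⟩
    · intro d
      by_cases hd : (j, d) = (q1, q2)
      · rw [hd, Function.update_self]; exact hle
      · rw [Function.update_of_ne hd]; exact (hu j).1 d
    · by_cases hj : j = q1
      · subst hj
        exact ⟨c, by rw [Function.update_of_ne hc1]; exact hc2⟩
      · obtain ⟨d, hd⟩ := (hu j).2.1
        exact ⟨d, by rw [Function.update_of_ne (by simp [hj])]; exact hd⟩
    · intro d hd
      rw [Function.update_of_ne]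
      · exact (hu j).2.2 d hd
      · intro h
        simp only [Prod.mk.injEq] at h
        obtain ⟨rfl, rfl⟩ := h
        omega
  by_cases hcase : |u (i, a)| = L
  · -- the other coordinate moves
    obtain ⟨η, hη, hηL⟩ : ∃ η : ℤ, (η = 1 ∨ η = -1) ∧ |u (i, b) + η| ≤ L := by
      rcases abs_choice (u (i, b)) with h | h
      · exact ⟨-1, by simp, by rw [abs_le]; omega⟩
      · exact ⟨1, by simp, by rw [abs_le]; omega⟩
    have uniqη : ∀ (c : Fin N) (η η' : ℤ), (η = 1 ∨ η = -1) → (η' = 1 ∨ η' = -1) →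
        |u (i, c)| = L → |u (i, c) + η| ≤ L → |u (i, c) + η'| ≤ L → η = η' := by
      intro c η η' hη hη' h1 h2 h3
      rw [abs_le] at h2 h3
      rcases abs_choice (u (i, c)) with h | h <;> rcases hη with rfl | rfl <;>
        rcases hη' with rfl | rfl <;> omega
    refine ⟨Function.update u (i, b) (u (i, b) + η), ?_, ?_, ⟨_, η, hη, hbe, rfl⟩, ?_⟩
    · intro h
      have := congrFun h (i, b)
      rw [Function.update_self, Function.update_of_ne hba'] at this
      rcases hη with rfl | rfl <;> omega
    · exact hux _ _ rfl hbA hηL ⟨a, hba'.symm, hcase⟩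
    · rintro y hy ⟨q, η', hη', hq, rfl⟩
      rcases pos _ hy q η' hη' hq rfl with rfl | rfl
      · left
        have h2 := (hy i).1 a
        have h3 := (hx i).1 a
        rw [Function.update_self] at h2 h3
        rw [uniqη a η' ε hη' hε hcase h2 h3]
      · right
        have h2 := (hy i).1 b
        rw [Function.update_self] at h2
        rw [uniqη b η' η hη' hη hb h2 hηL]
  · have hlt : |u (i, a)| < L := lt_of_le_of_ne ((hu i).1 a) hcase
    have hLe : |u (i, a) - ε| ≤ L := by
      rw [abs_lt] at hlt
      rw [abs_le]
      rcases hε with rfl | rfl <;> constructor <;> omega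
    refine ⟨Function.update u (i, a) (u (i, a) - ε), ?_, ?_, ⟨_, -ε, ?_, hp, rfl⟩, ?_⟩
    · intro h
      have := congrFun h (i, a)
      rw [Function.update_self, Function.update_self] at this
      rcases hε with rfl | rfl <;> omega
    · exact hux (i, a) (-ε) rfl haA hLe ⟨b, hba', hb⟩
    · rcases hε with rfl | rfl <;> simp
    · rintro y hy ⟨q, η', hη', hq, rfl⟩
      rcases pos _ hy q η' hη' hq rfl with rfl | rfl
      · rcases hε with rfl | rfl <;> rcases hη' with rfl | rfl
        · left; rfl
        · right; rfl
        · right; rw [sub_neg_eq_add]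
        · left; rfl
      · exfalso
        obtain ⟨c, hc'⟩ := (hy i).2.1
        have hcb : c ≠ b := by
          rintro rfl
          rw [Function.update_self] at hc'
          have h2 := hodd _ _ hη' hq
          rw [← Int.not_even_iff_odd, ← even_abs, hc'] at h2
          exact h2 hL
        rw [Function.update_of_ne (by simpa using hcb)] at hc'
        by_cases hca : c = a
        · subst hca; exact hcase hc'
        · have hcA : (c : ℕ) ≤ δ i := act _ hu i c (by
            intro h; rw [h] at hc'; simp at hc'; omega)
          exact hcb (uniq_even δ hδ hL hx hcx i c b hcA hbA
            (by rw [Function.update_of_ne (by simpa using hca), ← even_abs, hc']; exact hL)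
            (by rw [Function.update_of_ne hba']; exact hbe))

end Grid

end GHR

namespace GHR

section Chains
variable {k : ℕ}

abbrev Gam (k : ℕ) := Fin k → ℤˣ

def Vtx (N : ℕ) (δ : Fin k → ℕ) (L : ℤ) : Type := {v : Fin k × Fin N → ℤ // Valid δ L v}

variable {N : ℕ} {δ : Fin k → ℕ} {L : ℤ}

theorem unit_abs (g : ℤˣ) (x : ℤ) : |(g : ℤ) * x| = |x| := by
  rw [abs_mul]; rcases Int.units_eq_one_or g with rfl | rfl <;> simp

theorem Valid.act (g : Gam k) {v : Fin k × Fin N → ℤ} (h : Valid δ L v) :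
    Valid δ L (fun p => (g p.1 : ℤ) * v p) := by
  intro i
  refine ⟨fun a => ?_, ?_, fun a ha => ?_⟩
  · simp only [unit_abs]; exact (h i).1 a
  · obtain ⟨a, ha⟩ := (h i).2.1
    exact ⟨a, by simp only [unit_abs]; exact ha⟩
  · simp only [(h i).2.2 a ha, mul_zero]

instance (priority := 5000) actV : MulAction (Gam k) (Vtx N δ L) where
  smul g v := ⟨fun p => (g p.1 : ℤ) * v.1 p, v.2.act g⟩
  one_smul v := Subtype.ext (by funext p; show ((1 : ℤˣ) : ℤ) * v.1 p = _; simp)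
  mul_smul g h v := Subtype.ext (by
    funext p; show ((g p.1 * h p.1 : ℤˣ) : ℤ) * v.1 p = (g p.1 : ℤ) * ((h p.1 : ℤ) * v.1 p)
    push_cast; ring)

theorem smul_val (g : Gam k) (v : Vtx N δ L) (p) : (g • v).1 p = (g p.1 : ℤ) * v.1 p := rfl

theorem Vtx.ex_ne (hL : 0 < L) (v : Vtx N δ L) (i : Fin k) : ∃ a, v.1 (i, a) ≠ 0 := by
  obtain ⟨a, ha⟩ := (v.2 i).2.1
  exact ⟨a, fun h => by rw [h] at ha; simp at ha; omega⟩

theorem smul_free (hL : 0 < L) (g : Gam k) (v : Vtx N δ L) (h : g • v = v) : g = 1 := by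
  funext i
  obtain ⟨a, ha⟩ := v.ex_ne hL i
  have := congrArg (fun w : Vtx N δ L => w.1 (i, a)) h
  simp only [smul_val] at this
  rcases Int.units_eq_one_or (g i) with h1 | h1
  · exact h1
  · rw [h1] at this; simp at this; omega

theorem Step.act (g : Gam k) {v w : Fin k × Fin N → ℤ} (h : Step v w) :
    Step (fun p => (g p.1 : ℤ) * v p) (fun p => (g p.1 : ℤ) * w p) := by
  obtain ⟨p, ε, hε, hp, rfl⟩ := h
  refine ⟨p, g p.1 * ε, ?_, hp.mul_left _, ?_⟩
  · rcases Int.units_eq_one_or (g p.1) with h1 | h1 <;> rw [h1] <;> rcases hε with rfl | rfl <;> simp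
  · funext q
    by_cases hq : q = p
    · subst hq; simp [mul_add]
    · simp [Function.update_of_ne hq]

instance : Finite (Vtx N δ L) := by
  have : ({v : Fin k × Fin N → ℤ | Valid δ L v}).Finite := by
    apply Set.Finite.subset (Set.finite_Icc (fun _ => -L) (fun _ => L))
    intro v hv
    refine ⟨fun p => ?_, fun p => ?_⟩
    · exact (abs_le.1 ((hv p.1).1 p.2)).1
    · exact (abs_le.1 ((hv p.1).1 p.2)).2
  exact this.to_subtype

def IsCh (σ : ℕ → Vtx N δ L) : Prop :=
  (∀ p, Even ((σ 0).1 p)) ∧ (∀ m < ∑ i, δ i, Step (σ m).1 (σ (m + 1)).1) ∧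
    ∀ m, ∑ i, δ i ≤ m → σ m = σ (∑ i, δ i)

/-- maximal chains -/
def Ch (N : ℕ) (δ : Fin k → ℕ) (L : ℤ) : Type := {σ : ℕ → Vtx N δ L // IsCh σ}

theorem Ch.ext' {σ σ' : Ch N δ L} (h : ∀ i ≤ ∑ i, δ i, σ.1 i = σ'.1 i) : σ = σ' := by
  apply Subtype.ext
  funext i
  by_cases hi : i ≤ ∑ i, δ i
  · exact h i hi
  · rw [σ.2.2.2 i (by omega), σ'.2.2.2 i (by omega), h _ le_rfl]

instance : Finite (Ch N δ L) := by
  apply Finite.of_injective (fun (σ : Ch N δ L) (i : Fin ((∑ i, δ i) + 1)) => σ.1 i)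
  intro σ σ' h
  apply Ch.ext'
  intro i hi
  exact congrFun h ⟨i, by omega⟩

instance (priority := 5000) actC : MulAction (Gam k) (Ch N δ L) where
  smul g σ := ⟨fun i => g • σ.1 i, fun p => (σ.2.1 p).mul_left _, fun m hm => (σ.2.2.1 m hm).act g,
    fun m hm => congrArg (fun x => g • x) (σ.2.2.2 m hm)⟩
  one_smul σ := Subtype.ext (by funext i; exact one_smul _ (σ.1 i))
  mul_smul g h σ := Subtype.ext (by funext i; exact mul_smul g h (σ.1 i))

theorem Ch.smul_val (g : Gam k) (σ : Ch N δ L) : (g • σ).1 = fun i => g • σ.1 i := rfl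

theorem Ch.card (σ : Ch N δ L) (m : ℕ) (hm : m ≤ ∑ i, δ i) : (oddset (σ.1 m).1).card = m := by
  induction m with
  | zero =>
    rw [Finset.card_eq_zero, oddset, Finset.filter_eq_empty_iff]
    intro p _
    rw [Int.not_odd_iff_even]; exact σ.2.1 p
  | succ m ih => rw [(σ.2.2.1 m (by omega)).card, ih (by omega)]

theorem flip_exists (hδ : ∀ i, δ i < N) (hL : Even L) (hLp : 0 < L) (hD : 1 ≤ ∑ i, δ i)
    (m : ℕ) (hm : m ≤ ∑ i, δ i) (σ : Ch N δ L) :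
    ∃ σ' : Ch N δ L, σ' ≠ σ ∧ (∀ i ≤ ∑ i, δ i, i ≠ m → σ'.1 i = σ.1 i) ∧
      ∀ σ'' : Ch N δ L, (∀ i ≤ ∑ i, δ i, i ≠ m → σ''.1 i = σ.1 i) → σ'' = σ ∨ σ'' = σ' := by
  set D := ∑ i, δ i with hDdef
  -- reduce to the local statement
  suffices H : ∃ x' : Vtx N δ L, x' ≠ σ.1 m ∧ (m = 0 → ∀ p, Even (x'.1 p)) ∧
      (∀ l, m = l + 1 → Step (σ.1 l).1 x'.1) ∧ (m < D → Step x'.1 (σ.1 (m + 1)).1) ∧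
      ∀ y : Vtx N δ L, (m = 0 → ∀ p, Even (y.1 p)) → (∀ l, m = l + 1 → Step (σ.1 l).1 y.1) →
        (m < D → Step y.1 (σ.1 (m + 1)).1) → y = σ.1 m ∨ y = x' by
    obtain ⟨x', hx1, hx2, hx3, hx4, hx5⟩ := H
    have hch : IsCh (fun i => if min i D = m then x' else σ.1 i) := by
      refine ⟨?_, ?_, ?_⟩
      · simp only [Nat.zero_min]
        split_ifs with h
        · exact hx2 h.symm
        · exact σ.2.1
      · intro l hl
        change l < D at hl
        simp only
        have := σ.2.2.1 l hl
        rw [min_eq_left hl.le, min_eq_left (by omega : l + 1 ≤ D)]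
        by_cases h1 : l = m
        · rw [if_pos h1, if_neg (by omega)]
          subst h1; exact hx4 hl
        · rw [if_neg h1]
          split_ifs with h2
          · exact hx3 l h2.symm
          · exact this
      · intro l hl
        change D ≤ l at hl
        simp only
        change (if min l D = m then x' else σ.1 l) = if min D D = m then x' else σ.1 D
        rw [min_eq_right hl, min_self, σ.2.2.2 l hl]
    refine ⟨⟨_, hch⟩, ?_, ?_, ?_⟩
    · intro h
      have := congrArg (fun s : Ch N δ L => s.1 m) h
      simp only [min_eq_left hm, if_true] at this
      exact hx1 this
    · intro i hi him
      simp only [min_eq_left hi, if_neg him]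
    · intro σ'' hs
      have := hx5 (σ''.1 m) (by rintro rfl; exact σ''.2.1)
        (by
          rintro l rfl
          rw [← hs l (by omega) (by omega)]
          exact σ''.2.2.1 l (by omega))
        (by
          intro h
          rw [← hs (m+1) (by omega) (by omega)]
          exact σ''.2.2.1 m h)
      rcases this with h | h
      · left
        apply Ch.ext'
        intro i hi
        by_cases him : i = m
        · rw [him, h]
        · exact hs i hi him
      · right
        apply Ch.ext'
        intro i hi
        simp only [min_eq_left (show i ≤ D from hi)]
        by_cases him : i = m
        · rw [if_pos him, him, h]
        · rw [if_neg him]; exact hs i hi him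
  rcases Nat.eq_zero_or_pos m with rfl | hmp
  · obtain ⟨x', h1, h2, h3, h4, h5⟩ := bot_lemma δ hL (σ.1 0).2 (σ.1 1).2 σ.2.1 (σ.2.2.1 0 hD)
    refine ⟨⟨x', h2⟩, fun h => h1 (congrArg Subtype.val h), fun _ => h3, fun l hl => by omega,
      fun _ => h4, ?_⟩
    intro y hy1 _ hy2
    rcases h5 y.1 (hy1 rfl) (hy2 hD) with h | h
    · left; exact Subtype.ext h
    · right; exact Subtype.ext h
  · obtain ⟨l, rfl⟩ : ∃ l, m = l + 1 := ⟨m - 1, by omega⟩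
    have hl := σ.2.2.1 l (by omega)
    by_cases hmD : l + 1 < D
    · have hr := σ.2.2.1 (l + 1) hmD
      obtain ⟨x', h1, h2, h3, h4, h5⟩ := mid_lemma δ hL (σ.1 l).2 (σ.1 (l + 1 + 1)).2 hl hr
      refine ⟨⟨x', h2⟩, fun h => h1 (congrArg Subtype.val h), fun h => by omega,
        fun l' hl' => by obtain rfl : l = l' := by omega
                         exact h3,
        fun _ => h4, ?_⟩
      intro y _ hy1 hy2
      rcases h5 y.1 (hy1 l rfl) (hy2 hmD) with h | h
      · left; exact Subtype.ext h
      · right; exact Subtype.ext h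
    · obtain ⟨x', h1, h2, h3, h5⟩ := top_lemma δ hδ hL hLp (σ.1 l).2 (σ.1 (l + 1)).2
        (by rw [σ.card l (by omega)]; omega) hl
      refine ⟨⟨x', h2⟩, fun h => h1 (congrArg Subtype.val h), fun h => by omega,
        fun l' hl' => by obtain rfl : l = l' := by omega
                         exact h3,
        fun h => by omega, ?_⟩
      intro y _ hy1 hy2
      rcases h5 y.1 y.2 (hy1 l rfl) with h | h
      · left; exact Subtype.ext h
      · right; exact Subtype.ext h

noncomputable instance : Fintype (MulAction.orbitRel.Quotient (Gam k) (Ch N δ L)) :=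
  have : Finite (MulAction.orbitRel.Quotient (Gam k) (Ch N δ L)) := Quotient.finite _
  Fintype.ofFinite _

/-- evaluation on the fundamental class of the quotient -/
noncomputable def integ (c : Ch N δ L → ZMod 2) : ZMod 2 :=
  ∑ q : MulAction.orbitRel.Quotient (Gam k) (Ch N δ L), c q.out

theorem integ_add (c c' : Ch N δ L → ZMod 2) : integ (c + c') = integ c + integ c' := by
  simp [integ, Finset.sum_add_distrib]

theorem integ_sum {ι : Type*} (s : Finset ι) (c : ι → Ch N δ L → ZMod 2) :
    integ (fun σ => ∑ i ∈ s, c i σ) = ∑ i ∈ s, integ (c i) := by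
  simp only [integ]
  rw [Finset.sum_comm]

theorem out_rel (σ : Ch N δ L) : ∃ g : Gam k,
    (Quotient.mk'' σ : MulAction.orbitRel.Quotient (Gam k) (Ch N δ L)).out = g • σ := by
  have : (MulAction.orbitRel (Gam k) (Ch N δ L)) (Quotient.mk'' σ : MulAction.orbitRel.Quotient (Gam k) (Ch N δ L)).out σ :=
    Quotient.exact' (Quotient.out_eq' _)
  rw [MulAction.orbitRel_apply] at this
  obtain ⟨g, hg⟩ := this
  exact ⟨g, hg.symm⟩

theorem mk_eq {σ σ' : Ch N δ L} : (Quotient.mk'' σ : MulAction.orbitRel.Quotient (Gam k) (Ch N δ L)) =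
    Quotient.mk'' σ' ↔ ∃ g : Gam k, σ = g • σ' := by
  rw [Quotient.eq'', MulAction.orbitRel_apply]
  constructor
  · rintro ⟨g, hg⟩; exact ⟨g, hg.symm⟩
  · rintro ⟨g, hg⟩; exact ⟨g, hg.symm⟩

theorem integ_invol (θ : Ch N δ L → Ch N δ L) (c : Ch N δ L → ZMod 2)
    (hc : ∀ (g : Gam k) σ, c (g • σ) = c σ) (h1 : ∀ (g : Gam k) σ, ∃ g' : Gam k, θ (g • σ) = g' • θ σ)
    (h2 : ∀ σ, θ (θ σ) = σ) (h3 : ∀ (g : Gam k) σ, θ σ ≠ g • σ) (h4 : ∀ σ, c (θ σ) = c σ) :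
    integ c = 0 := by
  unfold integ
  let Θ : MulAction.orbitRel.Quotient (Gam k) (Ch N δ L) → MulAction.orbitRel.Quotient (Gam k) (Ch N δ L) :=
    fun q => Quotient.mk'' (θ q.out)
  have hΘ : ∀ σ, Θ (Quotient.mk'' σ) = Quotient.mk'' (θ σ) := by
    intro σ
    obtain ⟨g, hg⟩ := out_rel σ
    simp only [Θ, hg]
    rw [mk_eq]
    exact h1 g σ
  refine Finset.sum_involution (fun q _ => Θ q) ?_ ?_ (fun _ _ => Finset.mem_univ _) ?_
  · intro q _
    obtain ⟨g, hg⟩ := out_rel (θ q.out)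
    simp only [Θ]
    rw [hg, hc, h4]
    exact CharTwo.add_self_eq_zero _
  · intro q _ _ h
    have : Θ q = Quotient.mk'' q.out := by rw [h]; exact (Quotient.out_eq' q).symm
    simp only [Θ] at this
    rw [mk_eq] at this
    obtain ⟨g, hg⟩ := this
    exact h3 _ _ hg
  · intro q _
    show Θ (Θ q) = q
    have : Θ q = Quotient.mk'' (θ q.out) := rfl
    rw [this, hΘ, h2]
    exact Quotient.out_eq' q

theorem integ_dl (hδ : ∀ i, δ i < N) (hL : Even L) (hLp : 0 < L) (n : ℕ) (hD : ∑ i, δ i = n + 1)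
    (b : (ℕ → Vtx N δ L) → ZMod 2) (hb : Inv (Gam k) b) (hdep : Dep n b) :
    integ (fun σ : Ch N δ L => dl n b σ.1) = 0 := by
  simp only [dl]
  rw [integ_sum (Finset.range (n + 2)) (fun m (σ : Ch N δ L) => b (skip m σ.1))]
  apply Finset.sum_eq_zero
  intro m hm
  have hmD : m ≤ ∑ i, δ i := by have := Finset.mem_range.1 hm; omega
  choose θ hθ1 hθ2 hθ3 using flip_exists hδ hL hLp (by omega) m hmD
  apply integ_invol θ
  · intro g σ
    rw [← hb g (skip m σ.1)]
    congr 1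
    funext i
    simp only [skip, Ch.smul_val]
    split_ifs <;> rfl
  · intro g σ
    refine ⟨g, ?_⟩
    rcases hθ3 (g • σ) (g • θ σ) (fun i hi him => by
      simp only [Ch.smul_val, hθ2 σ i hi him]) with h | h
    · exact absurd (MulAction.injective g h) (hθ1 σ)
    · exact h.symm
  · intro σ
    rcases hθ3 (θ σ) σ (fun i hi him => (hθ2 σ i hi him).symm) with h | h
    · exact absurd h.symm (hθ1 σ)
    · exact h.symm
  · intro g σ h
    have : ∃ i ≤ ∑ i, δ i, i ≠ m := by
      by_cases h0 : m = 0
      · exact ⟨1, by omega, by omega⟩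
      · exact ⟨0, by omega, by omega⟩
    obtain ⟨i, hi, him⟩ := this
    have h2 := hθ2 σ i hi him
    rw [h] at h2
    have := smul_free hLp g _ h2
    subst this
    rw [one_smul] at h
    exact hθ1 σ h
  · intro σ
    apply hdep
    intro i hi
    simp only [skip]
    split_ifs with h
    · exact hθ2 σ i (by omega) (by omega)
    · exact hθ2 σ (i + 1) (by omega) (by omega)

theorem integ_coh (hδ : ∀ i, δ i < N) (hL : Even L) (hLp : 0 < L) (n : ℕ) (hD : ∑ i, δ i = n + 1)
    (c c' : (ℕ → Vtx N δ L) → ZMod 2) (h : Coh (Gam k) n c c') :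
    integ (fun σ : Ch N δ L => c σ.1) = integ (fun σ : Ch N δ L => c' σ.1) := by
  obtain ⟨b, hb1, hb2, hb3⟩ := h.bd
  have := integ_dl hδ hL hLp n hD b hb2 hb1
  rw [← hb3] at this
  have h2 := integ_add (fun σ : Ch N δ L => c σ.1) (fun σ : Ch N δ L => c' σ.1)
  have h3 : integ (fun σ : Ch N δ L => c σ.1) + integ (fun σ : Ch N δ L => c' σ.1) = 0 := by
    rw [← h2]; exact this
  exact CharTwo.add_eq_zero.1 h3

end Chains

end GHR

namespace GHR

section Eval
variable {k N : ℕ} {δ : Fin k → ℕ} {L : ℤ}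

open Classical in
noncomputable def lx (x : Fin N → ℤ) : ZMod 2 := if ∃ a, x a < 0 ∧ ∀ b < a, x b = 0 then 1 else 0

theorem lx_first {x : Fin N → ℤ} {a : Fin N} (h0 : x a ≠ 0) (h : ∀ b < a, x b = 0) :
    lx x = if x a < 0 then 1 else 0 := by
  unfold lx
  congr 1
  rw [eq_iff_iff]
  constructor
  · rintro ⟨c, hc, hc'⟩
    rcases lt_trichotomy a c with h1 | h1 | h1
    · exact absurd (hc' a h1) h0
    · rwa [h1]
    · rw [h c h1] at hc; omega
  · intro ha; exact ⟨a, ha, h⟩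

theorem ex_first {x : Fin N → ℤ} (h : ∃ a, x a ≠ 0) : ∃ a, x a ≠ 0 ∧ ∀ b < a, x b = 0 := by
  obtain ⟨a, ha, hm⟩ := WellFounded.has_min (wellFounded_lt (α := Fin N)) {a | x a ≠ 0} h
  exact ⟨a, ha, fun b hb => by by_contra hne; exact hm b hne hb⟩

def chi (i : Fin k) (g : Gam k) : ZMod 2 := if g i = 1 then 0 else 1

theorem lx_neg {x : Fin N → ℤ} (h : ∃ a, x a ≠ 0) : lx (fun a => - x a) = lx x + 1 := by
  obtain ⟨a, ha, hb⟩ := ex_first h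
  rw [lx_first ha hb, lx_first (x := fun a => - x a) (a := a) (by simpa using ha)
    (fun b h => by simp [hb b h])]
  simp only [Left.neg_neg_iff]
  by_cases h1 : x a < 0
  · rw [if_pos h1, if_neg (by omega)]; rfl
  · rw [if_neg h1, if_pos (by omega)]; rfl

noncomputable def lxv (i : Fin k) (v : Vtx N δ L) : ZMod 2 := lx (fun a => v.1 (i, a))

theorem lxv_smul (hLp : 0 < L) (i : Fin k) (g : Gam k) (v : Vtx N δ L) :
    lxv i (g • v) = lxv i v + chi i g := by
  unfold lxv chi
  simp only [smul_val]
  rcases Int.units_eq_one_or (g i) with h | h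
  · simp [h]
  · rw [h, if_neg (by decide), ← lx_neg (v.ex_ne hLp i)]
    simp

theorem lx_step {v w : Vtx N δ L} (hLp : 0 < L) (i : Fin k) (h : Step v.1 w.1)
    (hne : lxv i v ≠ lxv i w) : ∃ a : Fin N, (∀ b ≤ a, v.1 (i, b) = 0) ∧
      w.1 = Function.update v.1 (i, a) (if lxv i v = 0 then -1 else 1) := by
  obtain ⟨p, ε, hε, hp, hw⟩ := h
  obtain ⟨j, a⟩ := p
  have hij : j = i := by
    by_contra hij
    apply hne
    unfold lxv
    congr 1
    funext b
    rw [hw, Function.update_of_ne]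
    intro h; exact hij (congrArg Prod.fst h).symm
  subst hij
  obtain ⟨c, hc0, hc⟩ := ex_first (v.ex_ne hLp j)
  have hwb : ∀ b, b ≠ a → w.1 (j, b) = v.1 (j, b) := by
    intro b hb; rw [hw, Function.update_of_ne]
    intro h; exact hb (congrArg Prod.snd h)
  have hwa : w.1 (j, a) = v.1 (j, a) + ε := by rw [hw, Function.update_self]
  have hlv : lxv j v = if v.1 (j, c) < 0 then 1 else 0 := lx_first hc0 hc
  have hca : a < c := by
    by_contra hca
    rw [not_lt] at hca
    have h1 : w.1 (j, c) ≠ 0 ∧ (w.1 (j, c) < 0 ↔ v.1 (j, c) < 0) := by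
      by_cases hac : c = a
      · subst hac
        rw [hwa]
        obtain ⟨t, ht⟩ := hp
        rcases hε with rfl | rfl <;> omega
      · rw [hwb c hac]; exact ⟨hc0, Iff.rfl⟩
    have h2 : lxv j w = if w.1 (j, c) < 0 then 1 else 0 :=
      lx_first (x := fun a => w.1 (j, a)) h1.1 (fun b hb => by
        rw [hwb b (fun h => by subst h; exact absurd hb (not_lt.2 hca))]; exact hc b hb)
    apply hne
    rw [hlv, h2, if_congr h1.2 rfl rfl]
  have hva : v.1 (j, a) = 0 := hc a hca
  have h2 : lxv j w = if w.1 (j, a) < 0 then 1 else 0 :=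
      lx_first (x := fun a => w.1 (j, a)) (by rw [hwa, hva]; rcases hε with rfl | rfl <;> simp)
        (fun b hb => by rw [hwb b hb.ne]; exact hc b (hb.trans hca))
  refine ⟨a, fun b hb => hc b (hb.trans_lt hca), ?_⟩
  rw [hw, hva, zero_add]
  congr 1
  rw [hwa, hva, zero_add] at h2
  rw [h2] at hne
  by_cases hl : lxv j v = 0
  · rw [if_pos hl]
    rw [hl] at hne
    rcases hε with rfl | rfl
    · simp at hne
    · rfl
  · rw [if_neg hl]
    rcases hε with rfl | rfl
    · rfl
    · exfalso; simp at hne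
      revert hl hne
      generalize lxv j v = z
      revert z; decide

/-- the product along a word -/
noncomputable def wd (ψ : ℕ → Fin k) (σ : Ch N δ L) : ZMod 2 :=
  ∏ m ∈ Finset.range (∑ i, δ i), (lxv (ψ m) (σ.1 m) + lxv (ψ m) (σ.1 (m + 1)))

theorem wd_smul (hLp : 0 < L) (ψ : ℕ → Fin k) (g : Gam k) (σ : Ch N δ L) :
    wd ψ (g • σ) = wd ψ σ := by
  unfold wd
  apply Finset.prod_congr rfl
  intro m _
  simp only [Ch.smul_val, lxv_smul hLp]
  generalize lxv (ψ m) (σ.1 m) = x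
  generalize lxv (ψ m) (σ.1 (m + 1)) = y
  generalize chi (ψ m) g = z
  revert x y z; decide

theorem wd_ne {ψ : ℕ → Fin k} {σ : Ch N δ L} (h : wd ψ σ ≠ 0) (m : ℕ) (hm : m < ∑ i, δ i) :
    lxv (ψ m) (σ.1 m) ≠ lxv (ψ m) (σ.1 (m + 1)) := by
  intro he
  apply h
  apply Finset.prod_eq_zero (Finset.mem_range.2 hm)
  rw [he]; exact CharTwo.add_self_eq_zero _

abbrev cnt (ψ : ℕ → Fin k) (i : Fin k) (m : ℕ) : ℕ := Nat.count (fun l => ψ l = i) m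

theorem cnt_total (ψ : ℕ → Fin k) (m : ℕ) : ∑ i, cnt ψ i m = m := by
  induction m with
  | zero => simp
  | succ m ih =>
    simp only [Nat.count_succ]
    rw [Finset.sum_add_distrib]
    rw [show ∑ i, Nat.count (fun l => ψ l = i) m = m from ih]
    simp

/-- backward bound: the first nonzero position of block i at time m is at least cnt_D - cnt_m -/
theorem wd_zero (hLp : 0 < L) {ψ : ℕ → Fin k} {σ : Ch N δ L} (h : wd ψ σ ≠ 0) (i : Fin k)
    (t : ℕ) : ∀ m, m + t = ∑ i, δ i → ∀ b : Fin N, b.1 + cnt ψ i m < cnt ψ i (∑ i, δ i) →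
      (σ.1 m).1 (i, b) = 0 := by
  induction t with
  | zero => intro m hm b hb; rw [← hm] at hb; simp at hb
  | succ t ih =>
    intro m hm b hb
    have IH := ih (m + 1) (by omega)
    have hst := σ.2.2.1 m (by omega)
    have hne := wd_ne h m (by omega)
    obtain ⟨a, ha, hw⟩ := lx_step hLp (ψ m) hst hne
    have hc : cnt ψ i (m + 1) = cnt ψ i m + if ψ m = i then 1 else 0 := Nat.count_succ _ _
    by_cases hi : ψ m = i
    · rw [if_pos hi] at hc
      subst hi
      by_cases hba : b ≤ a
      · exact ha b hba
      · rw [not_le] at hba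
        -- w at a is nonzero, so a is not below the bound
        have h1 : ¬ (a.1 + cnt ψ (ψ m) (m + 1) < cnt ψ (ψ m) (∑ i, δ i)) := by
          intro h2
          have := IH a h2
          rw [hw, Function.update_self] at this
          split_ifs at this <;> omega
        have : a.1 < b.1 := hba
        omega
    · rw [if_neg hi] at hc
      have := IH b (by omega)
      rw [hw, Function.update_of_ne] at this
      · exact this
      · intro h; exact hi (congrArg Prod.fst h).symm

theorem wd_count (hLp : 0 < L) {ψ : ℕ → Fin k} {σ : Ch N δ L} (h : wd ψ σ ≠ 0) (i : Fin k) :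
    cnt ψ i (∑ i, δ i) = δ i := by
  have hle : ∀ i, cnt ψ i (∑ i, δ i) ≤ δ i := by
    intro i
    by_contra hlt
    rw [not_le] at hlt
    obtain ⟨a, ha⟩ := (σ.1 0).ex_ne hLp i
    apply ha
    by_cases had : δ i < a
    · exact ((σ.1 0).2 i).2.2 a had
    · exact wd_zero hLp h i (∑ i, δ i) 0 (by omega) a (by simp only [cnt, Nat.count_zero] at hlt ⊢; omega)
  have := (Finset.sum_eq_sum_iff_of_le (fun i _ => hle i)).1 (by rw [cnt_total])
  exact this i (Finset.mem_univ i)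

theorem wd_zero' (hLp : 0 < L) {ψ : ℕ → Fin k} {σ : Ch N δ L} (h : wd ψ σ ≠ 0) (i : Fin k)
    (m : ℕ) (hm : m ≤ ∑ i, δ i) (b : Fin N) (hb : b.1 + cnt ψ i m < δ i) :
      (σ.1 m).1 (i, b) = 0 :=
  wd_zero hLp h i (∑ i, δ i - m) m (by omega) b (by rwa [wd_count hLp h i])

theorem wd_fwd (hLp : 0 < L) {ψ : ℕ → Fin k} {σ : Ch N δ L} (h : wd ψ σ ≠ 0) (i : Fin k)
    (m : ℕ) (hm : m ≤ ∑ i, δ i) : ∃ b : Fin N, b.1 + cnt ψ i m ≤ δ i ∧ (σ.1 m).1 (i, b) ≠ 0 := by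
  induction m with
  | zero =>
    obtain ⟨a, ha⟩ := (σ.1 0).ex_ne hLp i
    refine ⟨a, ?_, ha⟩
    by_contra hc
    apply ha
    exact ((σ.1 0).2 i).2.2 a (by simpa using hc)
  | succ m ih =>
    obtain ⟨b, hb1, hb2⟩ := ih (by omega)
    obtain ⟨a, ha, hw⟩ := lx_step hLp (ψ m) (σ.2.2.1 m (by omega)) (wd_ne h m (by omega))
    have hc : cnt ψ i (m + 1) = cnt ψ i m + if ψ m = i then 1 else 0 := Nat.count_succ _ _
    by_cases hi : ψ m = i
    · rw [if_pos hi] at hc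
      subst hi
      have hab : a.1 < b.1 := by
        by_contra hab
        exact hb2 (ha b (not_lt.1 hab))
      refine ⟨a, by omega, ?_⟩
      rw [hw, Function.update_self]
      split_ifs <;> decide
    · rw [if_neg hi] at hc
      refine ⟨b, by omega, ?_⟩
      rw [hw, Function.update_of_ne]
      · exact hb2
      · intro h; exact hi (congrArg Prod.fst h).symm

/-- the changed coordinate is determined -/
theorem wd_step (hδ : ∀ i, δ i < N) (hLp : 0 < L) {ψ : ℕ → Fin k} {σ : Ch N δ L} (h : wd ψ σ ≠ 0)
    (m : ℕ) (hm : m < ∑ i, δ i) (σ' : Ch N δ L) (h' : wd ψ σ' ≠ 0) (he : σ.1 m = σ'.1 m) :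
    σ.1 (m + 1) = σ'.1 (m + 1) := by
  have key : ∀ σ : Ch N δ L, wd ψ σ ≠ 0 → ∃ a : Fin N, a.1 + cnt ψ (ψ m) m + 1 = δ (ψ m) ∧
      (σ.1 (m + 1)).1 = Function.update (σ.1 m).1 (ψ m, a) (if lxv (ψ m) (σ.1 m) = 0 then -1 else 1) := by
    intro σ h
    obtain ⟨a, ha, hw⟩ := lx_step hLp (ψ m) (σ.2.2.1 m hm) (wd_ne h m hm)
    refine ⟨a, ?_, hw⟩
    have hc : cnt ψ (ψ m) (m + 1) = cnt ψ (ψ m) m + 1 := by simp [cnt, Nat.count_succ]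
    have h1 : ¬ (a.1 + cnt ψ (ψ m) (m + 1) < δ (ψ m)) := by
      intro h2
      have := wd_zero' hLp h (ψ m) (m + 1) (by omega) a h2
      rw [hw, Function.update_self] at this
      split_ifs at this <;> omega
    have h2 : ¬ (δ (ψ m) ≤ a.1 + cnt ψ (ψ m) m) := by
      intro h2
      obtain ⟨b, hb1, hb⟩ := wd_fwd hLp h (ψ m) m hm.le
      exact hb (ha b (Fin.le_def.2 (by omega)))
    omega
  obtain ⟨a, ha, hw⟩ := key σ h
  obtain ⟨a', ha', hw'⟩ := key σ' h'
  obtain rfl : a = a' := Fin.ext (by omega)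
  apply Subtype.ext
  rw [hw, hw', he]

theorem wd_unique (hδ : ∀ i, δ i < N) (hLp : 0 < L) {ψ : ℕ → Fin k} {σ σ' : Ch N δ L}
    (h : wd ψ σ ≠ 0) (h' : wd ψ σ' ≠ 0) : ∃ g : Gam k, σ = g • σ' := by
  have key : ∀ σ : Ch N δ L, wd ψ σ ≠ 0 → ∀ i, |(σ.1 0).1 (i, ⟨δ i, hδ i⟩)| = L ∧
      ∀ b, b ≠ ⟨δ i, hδ i⟩ → (σ.1 0).1 (i, b) = 0 := by
    intro σ h i
    have h0 : ∀ b, b ≠ ⟨δ i, hδ i⟩ → (σ.1 0).1 (i, b) = 0 := by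
      intro b hb
      rcases lt_trichotomy b.1 (δ i) with h1 | h1 | h1
      · exact wd_zero' hLp h i 0 (by omega) b (by simpa using h1)
      · exact absurd (Fin.ext h1) hb
      · exact ((σ.1 0).2 i).2.2 b h1
    refine ⟨?_, h0⟩
    obtain ⟨a, ha⟩ := ((σ.1 0).2 i).2.1
    by_cases hb : a = ⟨δ i, hδ i⟩
    · rw [← hb]; exact ha
    · rw [h0 a hb] at ha; simp at ha; omega
  have hg : ∀ i, ∃ g : ℤˣ, (σ.1 0).1 (i, ⟨δ i, hδ i⟩) = g * (σ'.1 0).1 (i, ⟨δ i, hδ i⟩) := by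
    intro i
    have := (key σ h i).1.trans (key σ' h' i).1.symm
    rcases abs_eq_abs.1 this with h1 | h1
    · exact ⟨1, by simpa using h1⟩
    · exact ⟨-1, by simpa using h1⟩
  choose g hg using hg
  refine ⟨g, ?_⟩
  have hgs : wd ψ (g • σ') ≠ 0 := by rwa [wd_smul hLp]
  apply Ch.ext'
  intro m hm
  induction m with
  | zero =>
    apply Subtype.ext
    funext p
    obtain ⟨i, b⟩ := p
    rw [Ch.smul_val, smul_val]
    by_cases hb : b = ⟨δ i, hδ i⟩
    · rw [hb]; exact hg i
    · rw [(key σ h i).2 b hb, (key σ' h' i).2 b hb, mul_zero]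
  | succ m ih => exact wd_step hδ hLp h m (by omega) _ hgs (ih (by omega))

def v0 (δ : Fin k → ℕ) (L : ℤ) (ψ : ℕ → Fin k) (m : ℕ) (p : Fin k × Fin N) : ℤ :=
  if p.2.1 = δ p.1 then L else if p.2.1 < δ p.1 ∧ δ p.1 ≤ p.2.1 + cnt ψ p.1 m then
    (-1) ^ (δ p.1 - p.2.1) else 0

theorem v0_valid (hδ : ∀ i, δ i < N) (hLp : 0 < L) (ψ : ℕ → Fin k) (m : ℕ) :
    Valid (N := N) δ L (v0 δ L ψ m) := by
  intro i
  refine ⟨fun a => ?_, ⟨⟨δ i, hδ i⟩, ?_⟩, fun a ha => ?_⟩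
  · unfold v0
    split_ifs
    · exact (abs_of_pos hLp).le
    · simp [abs_pow]; omega
    · simp; omega
  · simp [v0, abs_of_pos hLp]
  · unfold v0
    rw [if_neg (by simp; omega), if_neg (by simp; omega)]

theorem v0_step (hδ : ∀ i, δ i < N) (ψ : ℕ → Fin k)
    (m : ℕ) (hm : cnt ψ (ψ m) (m + 1) ≤ δ (ψ m)) :
    Step (v0 (N := N) δ L ψ m) (v0 δ L ψ (m + 1)) := by
  have hc : ∀ i, cnt ψ i (m + 1) = cnt ψ i m + if ψ m = i then 1 else 0 := fun i => Nat.count_succ _ _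
  have hc1 := hc (ψ m)
  rw [if_pos rfl] at hc1
  have hN := hδ (ψ m)
  have ha : δ (ψ m) - cnt ψ (ψ m) (m + 1) < N := by omega
  have hz : v0 δ L ψ m (ψ m, (⟨δ (ψ m) - cnt ψ (ψ m) (m + 1), ha⟩ : Fin N)) = 0 := by
    unfold v0
    rw [if_neg (by simp; omega), if_neg (by simp; omega)]
  refine ⟨(ψ m, ⟨δ (ψ m) - cnt ψ (ψ m) (m + 1), ha⟩), (-1) ^ (cnt ψ (ψ m) (m + 1)),
    neg_one_pow_eq_or _ _, ?_, ?_⟩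
  · rw [hz]; exact Even.zero
  · funext p
    obtain ⟨i, b⟩ := p
    by_cases hp : (i, b) = (ψ m, (⟨δ (ψ m) - cnt ψ (ψ m) (m + 1), ha⟩ : Fin N))
    · rw [hp, Function.update_self, hz, zero_add]
      unfold v0
      rw [if_neg (by simp; omega), if_pos (by simp; omega)]
      congr 1
      simp only
      omega
    · rw [Function.update_of_ne hp]
      unfold v0
      simp only
      by_cases hi : i = ψ m
      · subst hi
        have hb : b.1 ≠ δ (ψ m) - cnt ψ (ψ m) (m + 1) := by
          intro h; exact hp (Prod.ext rfl (Fin.ext h))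
        have : (b.1 < δ (ψ m) ∧ δ (ψ m) ≤ b.1 + cnt ψ (ψ m) (m + 1)) ↔
           (b.1 < δ (ψ m) ∧ δ (ψ m) ≤ b.1 + cnt ψ (ψ m) m) := by omega
        simp only [this]
      · have := hc i
        rw [if_neg (fun h => hi h.symm), add_zero] at this
        rw [this]

theorem v0_lx (hδ : ∀ i, δ i < N) (hLp : 0 < L) (ψ : ℕ → Fin k) (i : Fin k)
    (m : ℕ) (hm : cnt ψ i m ≤ δ i) :
    lx (fun a : Fin N => v0 δ L ψ m (i, a)) = (cnt ψ i m : ZMod 2) := by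
  have hN := hδ i
  rw [lx_first (a := ⟨δ i - cnt ψ i m, by omega⟩)]
  · by_cases h0 : cnt ψ i m = 0
    · simp [h0, v0]; omega
    · have hv : v0 δ L ψ m (i, (⟨δ i - cnt ψ i m, by omega⟩ : Fin N)) = (-1) ^ cnt ψ i m := by
        unfold v0
        rw [if_neg (by simp only; omega), if_pos (by simp only; omega)]
        simp only
        rw [show δ i - (δ i - cnt ψ i m) = cnt ψ i m by omega]
      rw [hv]
      rcases Nat.even_or_odd (cnt ψ i m) with h | h
      · rw [h.neg_one_pow, if_neg (by omega), (ZMod.natCast_eq_zero_iff_even).2 h]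
      · rw [h.neg_one_pow, if_pos (by omega), (ZMod.natCast_eq_one_iff_odd).2 h]
  · unfold v0
    split_ifs with h1 h2
    · omega
    · simp
    · simp only at h1 h2; omega
  · intro b hb
    have : b.1 < δ i - cnt ψ i m := hb
    unfold v0
    rw [if_neg (by simp; omega), if_neg (by simp; omega)]

theorem wd_exists (hδ : ∀ i, δ i < N) (hL : Even L) (hLp : 0 < L) (ψ : ℕ → Fin k)
    (hc : ∀ i, cnt ψ i (∑ i, δ i) = δ i) : ∃ σ : Ch N δ L, wd ψ σ = 1 := by
  have hle : ∀ i, ∀ m ≤ ∑ i, δ i, cnt ψ i m ≤ δ i := by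
    intro i m hm
    rw [← hc i]
    exact Nat.count_monotone _ hm
  let σ : Ch N δ L := ⟨fun m => ⟨v0 δ L ψ (min m (∑ i, δ i)), v0_valid hδ hLp ψ _⟩, by
    refine ⟨?_, ?_, ?_⟩
    · intro p
      simp only [Nat.zero_min]
      unfold v0
      split_ifs with h1 h2
      · exact hL
      · simp at h2; omega
      · exact Even.zero
    · intro m hm
      simp only
      rw [min_eq_left hm.le, min_eq_left (by omega : m + 1 ≤ _)]
      exact v0_step hδ ψ m (hle _ _ hm)
    · intro m hm
      apply Subtype.ext
      simp only [min_eq_right hm, min_self]⟩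
  refine ⟨σ, ?_⟩
  unfold wd
  apply Finset.prod_eq_one
  intro m hm
  rw [Finset.mem_range] at hm
  have h1 : ∀ l ≤ ∑ i, δ i, lxv (ψ m) (σ.1 l) = (cnt ψ (ψ m) l : ZMod 2) := by
    intro l hl
    show lx (fun a : Fin N => v0 δ L ψ (min l (∑ i, δ i)) (ψ m, a)) = _
    rw [min_eq_left hl]
    exact v0_lx hδ hLp ψ _ l (hle _ _ hl)
  rw [h1 m hm.le, h1 (m + 1) hm, cnt, cnt, Nat.count_succ, if_pos rfl]
  push_cast
  generalize (Nat.count (fun l => ψ l = ψ m) m : ZMod 2) = z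
  revert z; decide

open Classical in
theorem wd_integ (hδ : ∀ i, δ i < N) (hL : Even L) (hLp : 0 < L) (ψ : ℕ → Fin k) :
    integ (wd (N := N) (δ := δ) (L := L) ψ) = if ∀ i, cnt ψ i (∑ i, δ i) = δ i then 1 else 0 := by
  split_ifs with hc
  · obtain ⟨σ, hσ⟩ := wd_exists (L := L) hδ hL hLp ψ hc
    unfold integ
    rw [Finset.sum_eq_single (Quotient.mk'' σ)]
    · obtain ⟨g, hg⟩ := out_rel σ
      rw [hg, wd_smul hLp, hσ]
    · intro q _ hq
      by_contra h
      apply hq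
      rw [← Quotient.out_eq' q, mk_eq]
      exact wd_unique hδ hLp h (by rw [hσ]; decide)
    · intro h; exact absurd (Finset.mem_univ _) h
  · unfold integ
    apply Finset.sum_eq_zero
    intro q _
    by_contra h
    exact hc (wd_count hLp h)

open Classical in
theorem eval_poly (hδ : ∀ i, δ i < N) (hL : Even L) (hLp : 0 < L) (hk : 0 < k)
    (α : ℕ → Finset (Fin k)) :
    integ (fun σ : Ch N δ L => ∏ m ∈ Finset.range (∑ i, δ i),
      ((∑ i ∈ α m, lxv i (σ.1 m)) + ∑ i ∈ α m, lxv i (σ.1 (m + 1)))) =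
    MvPolynomial.coeff (Finsupp.equivFunOnFinite.symm δ)
      (∏ m ∈ Finset.range (∑ i, δ i), ∑ i ∈ α m, (MvPolynomial.X i : MvPolynomial (Fin k) (ZMod 2))) := by
  set D := ∑ i, δ i with hD
  let ext : (Fin D → Fin k) → ℕ → Fin k := fun φ m => if h : m < D then φ ⟨m, h⟩ else ⟨0, hk⟩
  have e1 : ∀ σ : Ch N δ L, ∏ m ∈ Finset.range D,
      ((∑ i ∈ α m, lxv i (σ.1 m)) + ∑ i ∈ α m, lxv i (σ.1 (m + 1))) =
      ∑ φ ∈ Fintype.piFinset (fun m : Fin D => α m), wd (ext φ) σ := by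
    intro σ
    rw [← Fin.prod_univ_eq_prod_range (fun m => ((∑ i ∈ α m, lxv i (σ.1 m)) + ∑ i ∈ α m, lxv i (σ.1 (m + 1))))]
    simp only [← Finset.sum_add_distrib]
    rw [Finset.prod_univ_sum]
    apply Finset.sum_congr rfl
    intro φ _
    unfold wd
    rw [← Fin.prod_univ_eq_prod_range (fun m => (lxv (ext φ m) (σ.1 m) + lxv (ext φ m) (σ.1 (m + 1))))]
    apply Finset.prod_congr rfl
    intro m _
    have : ext φ m = φ m := dif_pos m.2
    rw [this]
  rw [show (fun σ : Ch N δ L => ∏ m ∈ Finset.range D,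
      ((∑ i ∈ α m, lxv i (σ.1 m)) + ∑ i ∈ α m, lxv i (σ.1 (m + 1)))) = _ from funext e1, integ_sum,
    ← Fin.prod_univ_eq_prod_range (fun m => ∑ i ∈ α m, (MvPolynomial.X i : MvPolynomial (Fin k) (ZMod 2))),
    Finset.prod_univ_sum, MvPolynomial.coeff_sum]
  apply Finset.sum_congr rfl
  intro φ _
  rw [wd_integ hδ hL hLp]
  have : ∏ m : Fin D, (MvPolynomial.X (φ m) : MvPolynomial (Fin k) (ZMod 2)) =
      MvPolynomial.monomial (∑ m : Fin D, Finsupp.single (φ m) 1) 1 := by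
    rw [MvPolynomial.monomial_sum_one]; rfl
  rw [this, MvPolynomial.coeff_monomial]
  congr 1
  rw [eq_iff_iff, Finsupp.ext_iff]
  apply forall_congr'
  intro i
  have : (∑ m : Fin D, Finsupp.single (φ m) 1) i = cnt (ext φ) i D := by
    rw [Finsupp.finsetSum_apply, cnt, Nat.count_eq_card_filter_range, Finset.card_filter,
      ← Fin.sum_univ_eq_sum_range (fun m => if ext φ m = i then 1 else 0)]
    apply Finset.sum_congr rfl
    intro m _
    have : ext φ m = φ m := dif_pos m.2
    rw [this, Finsupp.single_apply]
  rw [this]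
  exact Iff.rfl

end Eval
end GHR

namespace GHR

section Moore
variable {R : Type*} [CommRing R] [CharP R 2]

noncomputable def EE (t : ℕ → R) (m : ℕ) (T : R) : R :=
  ∏ β ∈ (Finset.range m).powerset, (T + ∑ i ∈ β, t i)

theorem EE_succ' (t : ℕ → R) (m : ℕ) (T : R) : EE t (m + 1) T = EE t m T * EE t m (T + t m) := by
  unfold EE
  rw [Finset.range_add_one, Finset.prod_powerset_insert (by simp)]
  congr 1
  apply Finset.prod_congr rfl
  intro β hβ
  rw [Finset.sum_insert]
  · ring
  · intro h; have := Finset.mem_powerset.1 hβ h; simp at this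

theorem EE_add (t : ℕ → R) (m : ℕ) : ∀ T U : R, EE t m (T + U) = EE t m T + EE t m U := by
  induction m with
  | zero => intro T U; simp [EE]
  | succ m ih =>
    intro T U
    have h2 : (2 : R) = 0 := CharTwo.two_eq_zero
    simp only [EE_succ', ih]
    linear_combination (EE t m T * EE t m U) * h2

theorem EE_succ (t : ℕ → R) (m : ℕ) (T : R) :
    EE t (m + 1) T = EE t m T ^ 2 + EE t m (t m) * EE t m T := by
  rw [EE_succ', EE_add]; ring

theorem EE_zero (t : ℕ → R) (m i : ℕ) (h : i < m) : EE t m (t i) = 0 := by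
  unfold EE
  apply Finset.prod_eq_zero (i := {i})
  · simp [h]
  · simp [CharTwo.add_self_eq_zero]

theorem EE_form (t : ℕ → R) (m : ℕ) : ∃ u : ℕ → R, u m = 1 ∧ (∀ j, m < j → u j = 0) ∧
    ∀ T, EE t m T = ∑ j ∈ Finset.range (m + 1), u j * T ^ 2 ^ j := by
  induction m with
  | zero =>
    refine ⟨fun j => if j = 0 then 1 else 0, by simp, fun j hj => by simp; omega, fun T => by simp [EE]⟩
  | succ m ih =>
    obtain ⟨u, h1, h2, h3⟩ := ih
    refine ⟨fun j => (if j = 0 then 0 else u (j - 1) ^ 2) + EE t m (t m) * u j, ?_, ?_, ?_⟩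
    · simp [h1, h2]
    · intro j hj
      simp only
      rw [if_neg (by omega), h2 (j - 1) (by omega), h2 j (by omega)]; simp
    · intro T
      rw [EE_succ]
      simp only [add_mul, Finset.sum_add_distrib]
      congr 1
      · rw [Finset.sum_range_succ', h3, sum_pow_char]
        simp only [Nat.add_eq_zero_iff, one_ne_zero, and_false, if_false, if_true, zero_mul, add_zero, Nat.add_sub_cancel]
        apply Finset.sum_congr rfl
        intro x _
        rw [mul_pow, ← pow_mul, pow_succ 2 x]
      · rw [Finset.sum_range_succ, h2 (m + 1) (by omega), h3 T, Finset.mul_sum]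
        simp [mul_assoc]

theorem DD_eq (t : ℕ → R) (m : ℕ) : ∏ α ∈ (Finset.range m).powerset.erase ∅, (∑ i ∈ α, t i) =
    ∏ i ∈ Finset.range m, EE t i (t i) := by
  induction m with
  | zero => simp
  | succ m ih =>
    rw [Finset.prod_range_succ, ← ih]
    have : (Finset.range (m + 1)).powerset.erase ∅ = ((Finset.range m).powerset.erase ∅) ∪
        ((Finset.range m).powerset.image (insert m)) := by
      rw [Finset.range_add_one, Finset.powerset_insert, Finset.erase_union_distrib]
      congr 1
      apply Finset.erase_eq_of_notMem
      simp
    rw [this, Finset.prod_union, Finset.prod_image]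
    · congr 1
      unfold EE
      apply Finset.prod_congr rfl
      intro β hβ
      rw [Finset.sum_insert]
      intro h; have := Finset.mem_powerset.1 hβ h; simp at this
    · intro a ha b hb hab
      have h1 : m ∉ a := by intro h; have := Finset.mem_powerset.1 ha h; simp at this
      have h2 : m ∉ b := by intro h; have := Finset.mem_powerset.1 hb h; simp at this
      rw [← Finset.erase_insert h1, ← Finset.erase_insert h2, hab]
    · rw [Finset.disjoint_left]
      intro a ha hb
      obtain ⟨b, _, rfl⟩ := Finset.mem_image.1 hb
      have := Finset.mem_powerset.1 (Finset.mem_of_mem_erase ha) (Finset.mem_insert_self m b)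
      simp at this

theorem moore (t : ℕ → R) (k : ℕ) : ∏ α ∈ (Finset.range k).powerset.erase ∅, (∑ i ∈ α, t i) =
    ∑ σ : Equiv.Perm (Fin k), ∏ i : Fin k, t i ^ 2 ^ (σ i : ℕ) := by
  choose u hu1 hu2 hu3 using EE_form t
  let A : Matrix (Fin k) (Fin k) R := Matrix.of fun i j => t i ^ 2 ^ (j : ℕ)
  let U : Matrix (Fin k) (Fin k) R := Matrix.of fun l j => u j l
  let M : Matrix (Fin k) (Fin k) R := Matrix.of fun i j => EE t j (t i)
  have hM : M = A * U := by
    ext i j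
    rw [Matrix.mul_apply]
    simp only [M, A, U, Matrix.of_apply]
    rw [hu3, Fin.sum_univ_eq_sum_range (fun l => t i ^ 2 ^ l * u j l)]
    rw [← Finset.sum_subset (Finset.range_subset_range.2 (show (j : ℕ) + 1 ≤ k from j.2))]
    · apply Finset.sum_congr rfl; intros; ring
    · intro l _ hl
      rw [hu2 j l (by simpa using hl), mul_zero]
  have hdM : M.det = ∏ i : Fin k, EE t i (t i) := by
    rw [Matrix.det_of_isLowerTriangular]
    · rfl
    · intro i j hij
      exact EE_zero t j i hij
  have hdU : U.det = 1 := by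
    rw [Matrix.det_of_isUpperTriangular]
    · apply Finset.prod_eq_one; intro i _; exact hu1 i
    · intro i j hij
      exact hu2 j i hij
  rw [DD_eq, ← Fin.prod_univ_eq_prod_range (fun i => EE t i (t i)), ← hdM, hM, Matrix.det_mul, hdU, mul_one,
    ← Matrix.det_transpose, Matrix.det_apply]
  apply Finset.sum_congr rfl
  intro σ _
  have : ∀ (z : ℤˣ) (x : R), z • x = x := by
    intro z x
    rcases Int.units_eq_one_or z with rfl | rfl
    · simp
    · simp [CharTwo.neg_eq]
  rw [this]
  rfl

theorem moore_fin (k : ℕ) (t : Fin k → R) :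
    ∏ α ∈ (Finset.univ : Finset (Finset (Fin k))).erase ∅, (∑ i ∈ α, t i) =
    ∑ σ : Equiv.Perm (Fin k), ∏ i, t i ^ 2 ^ (σ i : ℕ) := by
  have := moore (fun i => if h : i < k then t ⟨i, h⟩ else 0) k
  simp only [Fin.is_lt, dite_true, Fin.eta] at this
  rw [← this]
  refine Finset.prod_bij (fun α _ => α.map Fin.valEmbedding) ?_ ?_ ?_ ?_
  · intro α hα
    simp at hα ⊢
    refine ⟨hα, fun x hx => ?_⟩
    obtain ⟨a, _, rfl⟩ := Finset.mem_map.1 hx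
    simp
  · intro a _ b _ h
    exact Finset.map_injective _ h
  · intro b hb
    simp at hb
    refine ⟨Finset.univ.filter (fun i : Fin k => i.1 ∈ b), ?_, ?_⟩
    · simp
      obtain ⟨x, hx⟩ := Finset.nonempty_iff_ne_empty.2 hb.1
      have hx' := hb.2 hx
      simp at hx'
      exact ⟨⟨x, hx'⟩, hx⟩
    · ext x
      simp only [Finset.mem_map, Finset.mem_filter, Finset.mem_univ, true_and, Fin.valEmbedding_apply]
      constructor
      · rintro ⟨a, ha, rfl⟩; exact ha
      · intro hx
        have hx' := hb.2 hx
        simp at hx'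
        exact ⟨⟨x, hx'⟩, hx, rfl⟩
  · intro α _
    rw [Finset.sum_map]
    simp

end Moore

section Coeff
open MvPolynomial

def dlt (K n : ℕ) (i : Fin (K + 2)) : ℕ :=
  if i.1 ≤ 1 then 2 ^ (n + K + 1) + 2 ^ n else 2 ^ (n + i.1)

def exf (K n : ℕ) (a b : ℕ) (i : Fin (K + 2)) : ℕ :=
  if i.1 = 0 then a else if i.1 = 1 then b else 2 ^ (n + i.1)

noncomputable def ex (K n a b : ℕ) : Fin (K + 2) →₀ ℕ := Finsupp.equivFunOnFinite.symm (exf K n a b)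

theorem coeff_X0 (K n a b : ℕ) (Q : MvPolynomial (Fin (K + 2)) (ZMod 2)) :
    coeff (ex K n (a + 1) b) (Q * X 0) = coeff (ex K n a b) Q := by
  rw [← coeff_mul_X (ex K n a b) 0 Q]
  congr 1
  ext i
  simp only [ex, exf, Finsupp.add_apply, Finsupp.equivFunOnFinite_symm_apply_apply, Finsupp.single_apply]
  by_cases h : i = 0
  · subst h; simp
  · have h1 : ¬ i.1 = 0 := fun h' => h (Fin.ext h')
    have h2 : ¬ 0 = i := fun h' => h h'.symm
    simp only [h1, h2, if_false, add_zero]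

theorem coeff_X1 (K n a b : ℕ) (Q : MvPolynomial (Fin (K + 2)) (ZMod 2)) :
    coeff (ex K n a (b + 1)) (Q * X 1) = coeff (ex K n a b) Q := by
  rw [← coeff_mul_X (ex K n a b) 1 Q]
  congr 1
  ext i
  simp only [ex, exf, Finsupp.add_apply, Finsupp.equivFunOnFinite_symm_apply_apply, Finsupp.single_apply]
  by_cases h : i = 1
  · subst h; simp
  · have h1 : ¬ i.1 = 1 := fun h' => h (Fin.ext (by simpa using h'))
    have h2 : ¬ 1 = i := fun h' => h h'.symm
    simp only [h1, h2, if_false, add_zero]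

theorem coeff_X00 (K n b : ℕ) (Q : MvPolynomial (Fin (K + 2)) (ZMod 2)) :
    coeff (ex K n 0 b) (Q * X 0) = 0 := by
  rw [coeff_mul_X', if_neg]
  simp [ex, exf]

theorem telesc (K n d : ℕ) (Q : MvPolynomial (Fin (K + 2)) (ZMod 2)) : ∀ c, c ≤ d →
    ∑ p ∈ Finset.range (c + 1), coeff (ex K n p (2 * d + 2 - p)) (Q * (X 0 + X 1)) =
      coeff (ex K n c (2 * d + 1 - c)) Q := by
  intro c
  induction c with
  | zero =>
    intro _
    rw [zero_add, Finset.sum_range_one, mul_add, coeff_add, coeff_X00, zero_add,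
      show 2 * d + 2 - 0 = (2 * d + 1) + 1 by omega, coeff_X1]
    rfl
  | succ c ih =>
    intro hc
    rw [Finset.sum_range_succ, ih (by omega), mul_add, coeff_add, coeff_X0,
      show 2 * d + 2 - (c + 1) = (2 * d + 1 - (c + 1)) + 1 by omega, coeff_X1,
      show 2 * d + 1 - (c + 1) + 1 = 2 * d + 1 - c by omega, ← add_assoc,
      CharTwo.add_self_eq_zero, zero_add]

theorem perm_unique (K n p : ℕ) (hp : p < 2 ^ (n + K + 1) + 2 ^ n) (σ : Equiv.Perm (Fin (K + 2)))
    (h : ∀ i, 2 ^ (σ i : ℕ) * 2 ^ (n + 1) = exf K n p (2 * (2 ^ (n + K + 1) + 2 ^ n) - p) i) :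
    (p = 2 ^ (n + 1)) ∧ ∀ i, (σ i : ℕ) = if i.1 = 0 then 0 else if i.1 = 1 then K + 1 else i.1 - 1 := by
  have h2 : ∀ i : Fin (K + 2), 2 ≤ i.1 → (σ i : ℕ) + 1 = i.1 := by
    intro i hi
    have := h i
    rw [exf, if_neg (by omega), if_neg (by omega), ← pow_add] at this
    have := Nat.pow_right_injective (le_refl 2) this
    omega
  have h3 : ∀ i : Fin (K + 2), i.1 ≤ 1 → (σ i : ℕ) = 0 ∨ (σ i : ℕ) = K + 1 := by
    intro i hi
    by_contra hc
    push Not at hc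
    have hlt := (σ i).2
    have := h2 ⟨(σ i : ℕ) + 1, by omega⟩ (by simp only; omega)
    simp only at this
    have h4 : σ ⟨(σ i : ℕ) + 1, by omega⟩ = σ i := Fin.ext (by omega)
    have := σ.injective h4
    rw [Fin.ext_iff] at this
    simp only at this
    omega
  have h0 : (σ 0 : ℕ) = 0 := by
    rcases h3 0 (by simp) with h4 | h4
    · exact h4
    · have := h 0
      rw [h4, exf, if_pos (by simp), ← pow_add] at this
      have e : 2 ^ (K + 1 + (n + 1)) = 2 * 2 ^ (n + K + 1) := by ring
      have : 2 ^ n ≤ 2 ^ (n + K + 1) := Nat.pow_le_pow_right (by omega) (by omega)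
      omega
  refine ⟨?_, ?_⟩
  · have := h 0
    rw [h0, exf, if_pos (by simp)] at this
    omega
  · intro i
    by_cases hi0 : i.1 = 0
    · rw [if_pos hi0]
      obtain rfl : i = 0 := Fin.ext hi0
      exact h0
    · rw [if_neg hi0]
      by_cases hi1 : i.1 = 1
      · rw [if_pos hi1]
        rcases h3 i (by omega) with h4 | h4
        · exfalso
          have : σ i = σ 0 := Fin.ext (by omega)
          have := σ.injective this
          rw [this] at hi0; simp at hi0
        · exact h4
      · rw [if_neg hi1]
        have := h2 i (by omega)
        omega

theorem perm_exists (K : ℕ) : ∃ σ : Equiv.Perm (Fin (K + 2)), ∀ i, (σ i : ℕ) =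
    if i.1 = 0 then 0 else if i.1 = 1 then K + 1 else i.1 - 1 := by
  let f : Fin (K + 2) → Fin (K + 2) := fun i =>
    ⟨if i.1 = 0 then 0 else if i.1 = 1 then K + 1 else i.1 - 1, by have := i.2; split_ifs <;> omega⟩
  have hf : Function.Injective f := by
    intro a b hab
    have := Fin.ext_iff.1 hab
    simp only [f] at this
    have ha := a.2
    have hb := b.2
    apply Fin.ext
    split_ifs at this <;> omega
  exact ⟨Equiv.ofBijective f (Finite.injective_iff_bijective.1 hf), fun i => rfl⟩

theorem coeff_main (K n : ℕ) (Q : MvPolynomial (Fin (K + 2)) (ZMod 2))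
    (hQ : Q * (X 0 + X 1) = ∏ α ∈ (Finset.univ : Finset (Finset (Fin (K + 2)))).erase ∅,
      (∑ i ∈ α, X i) ^ (2 ^ (n + 1))) :
    coeff (Finsupp.equivFunOnFinite.symm (dlt K n)) (Q * X 0) = 1 := by
  have hpos : 0 < 2 ^ n := by positivity
  obtain ⟨c, hc⟩ : ∃ c, 2 ^ (n + K + 1) + 2 ^ n = c + 1 := ⟨2 ^ (n + K + 1) + 2 ^ n - 1, (Nat.sub_add_cancel (Nat.succ_le_of_lt (by positivity))).symm⟩
  have e1 : Finsupp.equivFunOnFinite.symm (dlt K n) = ex K n (c + 1) (2 * c + 1 - c) := by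
    ext i
    simp only [ex, Finsupp.equivFunOnFinite_symm_apply_apply, dlt, exf, hc]
    by_cases h0 : i.1 = 0
    · simp [h0]
    · by_cases h1 : i.1 = 1
      · simp [h1]; omega
      · rw [if_neg (by omega), if_neg h0, if_neg h1]
  rw [e1, coeff_X0, ← telesc K n c Q c le_rfl, hQ, Finset.prod_pow, moore_fin,
    sum_pow_char_pow]
  have e2 : ∀ σ : Equiv.Perm (Fin (K + 2)), (∏ i, (X i : MvPolynomial (Fin (K + 2)) (ZMod 2)) ^ 2 ^ (σ i : ℕ)) ^ 2 ^ (n + 1) =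
      monomial (Finsupp.equivFunOnFinite.symm (fun i => 2 ^ (σ i : ℕ) * 2 ^ (n + 1))) 1 := by
    intro σ
    rw [monomial_eq, ← Finset.prod_pow, Finsupp.prod_fintype _ _ (by simp)]
    simp [pow_mul]
  simp only [e2, coeff_sum, coeff_monomial]
  have e3 : ∀ p < c + 1, ∀ σ : Equiv.Perm (Fin (K + 2)),
      Finsupp.equivFunOnFinite.symm (fun i => 2 ^ (σ i : ℕ) * 2 ^ (n + 1)) = ex K n p (2 * c + 2 - p) →
      (p = 2 ^ (n + 1)) ∧ ∀ i, (σ i : ℕ) = if i.1 = 0 then 0 else if i.1 = 1 then K + 1 else i.1 - 1 := by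
    intro p hp σ h
    apply perm_unique K n p (by omega) σ
    intro i
    have := DFunLike.congr_fun h i
    simp only [ex, Finsupp.equivFunOnFinite_symm_apply_apply] at this
    rw [this]
    congr 1
    omega
  obtain ⟨σ0, hσ0⟩ := perm_exists K
  have hJ : 2 ^ (n + 1) < c + 1 := by
    have : 2 ^ (n + 1) ≤ 2 ^ (n + K + 1) := Nat.pow_le_pow_right (by omega) (by omega)
    omega
  rw [Finset.sum_eq_single (2 ^ (n + 1)), Finset.sum_eq_single σ0, if_pos]
  · ext i
    simp only [ex, Finsupp.equivFunOnFinite_symm_apply_apply, exf, hσ0]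
    by_cases h0 : i.1 = 0
    · simp [h0]
    · rw [if_neg h0, if_neg h0]
      by_cases h1 : i.1 = 1
      · rw [if_pos h1, if_pos h1]
        have e : 2 ^ (K + 1) * 2 ^ (n + 1) = 2 * 2 ^ (n + K + 1) := by ring
        have e' : 2 ^ (n + 1) = 2 * 2 ^ n := by ring
        omega
      · rw [if_neg h1, if_neg h1, ← pow_add]
        congr 1
        omega
  · intro σ _ hσ
    rw [if_neg]
    intro h
    apply hσ
    ext i
    rw [(e3 _ hJ σ h).2 i, hσ0 i]
  · intro h; exact absurd (Finset.mem_univ _) h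
  · intro p hp hne
    apply Finset.sum_eq_zero
    intro σ _
    rw [if_neg]
    intro h
    exact hne (e3 p (Finset.mem_range.1 hp) σ h).1
  · intro h; exact absurd (Finset.mem_range.2 hJ) h

theorem dlt_sum (K n : ℕ) : ∑ i, dlt K n i = 2 ^ (n + 1) * (2 ^ (K + 2) - 1) := by
  rw [Fin.sum_univ_succ, Fin.sum_univ_succ]
  have : ∀ i : Fin K, dlt K n i.succ.succ = 2 ^ (n + 2) * 2 ^ i.1 := by
    intro i
    rw [dlt, if_neg (by simp)]
    simp only [Fin.val_succ]
    ring
  simp only [this]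
  rw [← Finset.mul_sum, Fin.sum_univ_eq_sum_range (fun i => 2 ^ i)]
  have h := Nat.geomSum_eq (le_refl 2) K
  rw [h]
  simp only [dlt]
  have hK : 1 ≤ 2 ^ K := Nat.one_le_two_pow
  have hK2 : 1 ≤ 2 ^ (K + 2) := Nat.one_le_two_pow
  zify [hK, hK2]
  simp
  ring

end Coeff
end GHR

namespace GHR

section Items
variable {k N : ℕ} {δ : Fin k → ℕ} {L : ℤ}

noncomputable def lxs (α : Finset (Fin k)) (v : Vtx N δ L) : ZMod 2 := ∑ i ∈ α, lxv i v

def chis (α : Finset (Fin k)) (g : Gam k) : ZMod 2 := ∑ i ∈ α, chi i g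

theorem lxs_smul (hLp : 0 < L) (α : Finset (Fin k)) (g : Gam k) (v : Vtx N δ L) :
    lxs α (g • v) = lxs α v + chis α g := by
  unfold lxs chis
  rw [← Finset.sum_add_distrib]
  exact Finset.sum_congr rfl (fun i _ => lxv_smul hLp i g v)

noncomputable def Wd : List (Finset (Fin k)) → (ℕ → Vtx N δ L) → ZMod 2
  | [] => fun _ => 1
  | α :: l => fun v => dd (lxs α) v * Wd l (shift 1 v)

theorem shift_shift {V : Type*} (a b : ℕ) (v : ℕ → V) : shift a (shift b v) = shift (b + a) v := by
  funext i; simp [shift, add_assoc]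

theorem shift_zero {V : Type*} (v : ℕ → V) : shift 0 v = v := by
  funext i; simp [shift]

theorem Wd_append (l l' : List (Finset (Fin k))) (v : ℕ → Vtx N δ L) :
    Wd (l ++ l') v = Wd l v * Wd l' (shift l.length v) := by
  induction l generalizing v with
  | nil => simp [Wd, shift_zero]
  | cons α l ih =>
    simp only [List.cons_append, Wd, ih, shift_shift, List.length_cons, mul_assoc]
    rw [add_comm 1]

theorem Wd_prod (l : List (Finset (Fin k))) (v : ℕ → Vtx N δ L) :
    Wd l v = ∏ m ∈ Finset.range l.length, (lxs (l.getD m ∅) (v m) + lxs (l.getD m ∅) (v (m + 1))) := by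
  induction l generalizing v with
  | nil => simp [Wd]
  | cons α l ih =>
    simp only [Wd]
    rw [ih, List.length_cons, Finset.prod_range_succ', mul_comm]
    congr 1
    apply Finset.prod_congr rfl
    intro m _
    simp [shift, add_comm, add_left_comm]

theorem list_prod {M : Type*} [CommMonoid M] (l : List (Finset (Fin k))) (f : Finset (Fin k) → M) :
    (l.map f).prod = ∏ m ∈ Finset.range l.length, f (l.getD m ∅) := by
  induction l with
  | nil => simp
  | cons α l ih =>
    rw [List.map_cons, List.prod_cons, ih, List.length_cons, Finset.prod_range_succ', mul_comm]
    simp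

theorem eval_list (hδ : ∀ i, δ i < N) (hL : Even L) (hLp : 0 < L) (hk : 0 < k)
    (l : List (Finset (Fin k))) (hl : l.length = ∑ i, δ i) :
    integ (fun σ : Ch N δ L => Wd l σ.1) = MvPolynomial.coeff (Finsupp.equivFunOnFinite.symm δ)
      (l.map (fun α => ∑ i ∈ α, (MvPolynomial.X i : MvPolynomial (Fin k) (ZMod 2)))).prod := by
  rw [list_prod, hl, ← eval_poly (L := L) hδ hL hLp hk (fun m => l.getD m ∅)]
  congr 1
  funext σ
  rw [Wd_prod, hl]
  rfl

structure It (N : ℕ) (δ : Fin k → ℕ) (L : ℤ) where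
  n : ℕ
  c : (ℕ → Vtx N δ L) → ZMod 2
  w : List (Finset (Fin k))
  len : w.length = n + 1
  coh : Coh (Gam k) n c (Wd w)

def ZZ : List (It N δ L) → (ℕ → Vtx N δ L) → ZMod 2
  | [] => fun _ => 1
  | it :: l => fun v => it.c v * ZZ l (shift (it.n + 1) v)

theorem coh_list (its : List (It N δ L)) : ∀ (n : ℕ) (c : (ℕ → Vtx N δ L) → ZMod 2)
    (w : List (Finset (Fin k))), w.length = n + 1 → Coh (Gam k) n c (Wd w) →
    ∃ n', (w ++ its.flatMap It.w).length = n' + 1 ∧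
      Coh (Gam k) n' (fun v => c v * ZZ its (shift (n + 1) v)) (Wd (w ++ its.flatMap It.w)) := by
  induction its with
  | nil =>
    intro n c w hw h
    refine ⟨n, by simpa using hw, ?_⟩
    simpa [ZZ] using h
  | cons it its ih =>
    intro n c w hw h
    have h1 := h.cup it.coh
    have e : cup (n + 1) (Wd w) (Wd it.w) = Wd (N := N) (δ := δ) (L := L) (w ++ it.w) := by
      funext v
      rw [Wd_append, hw]; rfl
    rw [e] at h1
    obtain ⟨n', h2, h3⟩ := ih _ _ _ (by rw [List.length_append, hw, it.len]; ring) h1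
    refine ⟨n', ?_, ?_⟩
    · rw [List.flatMap_cons, ← List.append_assoc]; exact h2
    · rw [List.flatMap_cons, ← List.append_assoc]
      convert h3 using 1
      funext v
      simp only [ZZ, cup, shift_shift, mul_assoc]
      rw [show n + 1 + (it.n + 1) = n + 1 + it.n + 1 by ring]

theorem ZZ_congr (its : List (It N δ L)) (v w : ℕ → Vtx N δ L)
    (h : ∀ it ∈ its, ∀ m, it.c (shift m v) = it.c (shift m w)) (m : ℕ) :
    ZZ its (shift m v) = ZZ its (shift m w) := by
  induction its generalizing m with
  | nil => rfl
  | cons it its ih =>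
    simp only [ZZ, shift_shift]
    rw [h it (by simp), ih (fun it' h' => h it' (by simp [h']))]

theorem ZZ_zero (its : List (It N δ L)) (v : ℕ → Vtx N δ L) (it : It N δ L) (hit : it ∈ its)
    (h : ∀ m, it.c (shift m v) = 0) (m : ℕ) : ZZ its (shift m v) = 0 := by
  induction its generalizing m with
  | nil => simp at hit
  | cons it' its ih =>
    simp only [ZZ, shift_shift]
    rcases List.mem_cons.1 hit with rfl | h'
    · rw [h, zero_mul]
    · rw [ih h', mul_zero]

theorem Wd_one (α : Finset (Fin k)) : Wd (N := N) (δ := δ) (L := L) [α] = dd (lxs α) := by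
  funext v; simp [Wd]

/-- single item -/
noncomputable def itS (hLp : 0 < L) (α : Finset (Fin k)) (s : Vtx N δ L → ZMod 2)
    (h : ∀ (g : Gam k) v, s (g • v) = s v + chis α g) : It N δ L where
  n := 0
  c := dd s
  w := [α]
  len := rfl
  coh := by rw [Wd_one]; exact Coh_dd s (lxs α) (chis α) h (lxs_smul hLp α)

/-- pair item -/
noncomputable def itP (hLp : 0 < L) (α β : Finset (Fin k)) (s0 s s' : Vtx N δ L → ZMod 2)
    (h0 : ∀ (g : Gam k) v, s0 (g • v) = s0 v)
    (h : ∀ (g : Gam k) v, s (g • v) = s v + chis α g)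
    (h' : ∀ (g : Gam k) v, s' (g • v) = s' v + chis β g) : It N δ L where
  n := 1
  c := ee s0 s s'
  w := [α, β]
  len := rfl
  coh := by
    have := Coh_ee s0 s s' (lxs α) (lxs β) (chis α) (chis β) h0 h h' (lxs_smul hLp α) (lxs_smul hLp β)
    convert this using 1
    funext v
    simp [Wd, cup]

theorem bu_comb (hδ : ∀ i, δ i < N) (hL : Even L) (hLp : 0 < L) (hk : 0 < k) (d : ℕ)
    (hd : ∑ i, δ i = d + 1)
    (α : Fin (d + 1) → Finset (Fin k)) (s : Fin (d + 1) → Vtx N δ L → ZMod 2)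
    (h : ∀ m (g : Gam k) v, s m (g • v) = s m v + chis (α m) g)
    (hc : MvPolynomial.coeff (Finsupp.equivFunOnFinite.symm δ)
      (∏ m, ∑ i ∈ α m, (MvPolynomial.X i : MvPolynomial (Fin k) (ZMod 2))) ≠ 0) :
    ∃ σ : Ch N δ L, ∀ m, ¬ ∀ a, s m (σ.1 a) = s m (σ.1 0) := by
  by_contra hcon
  push Not at hcon
  apply hc
  let its : List (It N δ L) := (List.finRange d).map (fun m => itS hLp (α m.succ) (s m.succ) (h m.succ))
  obtain ⟨n', h1, h2⟩ := coh_list its 0 (dd (s 0)) [α 0] rfl (by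
    rw [Wd_one]; exact Coh_dd (s 0) (lxs (α 0)) (chis (α 0)) (h 0) (lxs_smul hLp _))
  have hw : its.flatMap It.w = (List.finRange d).map (fun m => α m.succ) := by
    simp only [its, List.flatMap_map]
    show (List.finRange d).flatMap (fun m => [α m.succ]) = _
    induction (List.finRange d) with
    | nil => rfl
    | cons a l ih => simp [ih]
  rw [hw] at h1 h2
  have h3 : ∑ i, δ i = n' + 1 := by rw [hd, ← h1]; simp
  have h4 := integ_coh hδ hL hLp n' h3 _ _ h2
  rw [eval_list hδ hL hLp hk _ (by rw [h1, h3])] at h4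
  have h5 : (List.map (fun α => ∑ i ∈ α, (MvPolynomial.X i : MvPolynomial (Fin k) (ZMod 2)))
      ([α 0] ++ (List.finRange d).map (fun m => α m.succ))).prod = ∏ m, ∑ i ∈ α m, MvPolynomial.X i := by
    rw [Fin.prod_univ_succ, ← List.prod_ofFn, List.ofFn_eq_map]
    simp only [List.cons_append, List.nil_append, List.map_cons, List.prod_cons, List.map_map]
    rfl
  rw [← h5, ← h4]
  unfold integ
  apply Finset.sum_eq_zero
  intro q _
  obtain ⟨m, hm⟩ := hcon q.out
  show dd (s 0) q.out.1 * ZZ its (shift (0 + 1) q.out.1) = 0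
  refine Fin.cases ?_ (fun m hm => ?_) m hm
  · intro hm
    simp only [dd]
    rw [hm 1, CharTwo.add_self_eq_zero, zero_mul]
  · rw [ZZ_zero its q.out.1 (itS hLp (α m.succ) (s m.succ) (h m.succ)), mul_zero]
    · exact List.mem_map.2 ⟨m, List.mem_finRange m, rfl⟩
    · intro a
      show dd (s m.succ) _ = 0
      simp only [dd, shift]
      rw [hm (a + 0), hm (a + 1), CharTwo.add_self_eq_zero]

end Items

end GHR

namespace GHR

section Tau
variable {K N : ℕ} {δ : Fin (K + 2) → ℕ} {L : ℤ}

instance (priority := 10000) actV2 : SMul (Gam (K + 2)) (Vtx N δ L) := (actV (k := K + 2)).toSMul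
instance (priority := 10000) actC2 : SMul (Gam (K + 2)) (Ch N δ L) := (actC (k := K + 2)).toSMul

abbrev sw (K : ℕ) : Equiv.Perm (Fin (K + 2)) := Equiv.swap 0 1

theorem sw_sw (i : Fin (K + 2)) : sw K (sw K i) = i := Equiv.swap_apply_self 0 1 i

theorem sw_δ (h : δ 0 = δ 1) (i : Fin (K + 2)) : δ (sw K i) = δ i := by
  unfold sw
  by_cases h0 : i = 0
  · subst h0; simp [h]
  · by_cases h1 : i = 1
    · subst h1; simp [h]
    · rw [Equiv.swap_apply_of_ne_of_ne h0 h1]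

def tau (h : δ 0 = δ 1) (v : Vtx N δ L) : Vtx N δ L :=
  ⟨fun p => v.1 (sw K p.1, p.2), fun i => ⟨fun a => (v.2 (sw K i)).1 a, (v.2 (sw K i)).2.1,
    fun a ha => (v.2 (sw K i)).2.2 a (by rwa [sw_δ h])⟩⟩

theorem tau_tau (h : δ 0 = δ 1) (v : Vtx N δ L) : tau h (tau h v) = v := by
  apply Subtype.ext
  funext p
  show v.1 (sw K (sw K p.1), p.2) = v.1 p
  rw [sw_sw]

theorem tau_smul (h : δ 0 = δ 1) (g : Gam (K + 2)) (v : Vtx N δ L) :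
    tau h (g • v) = (fun i => g (sw K i) : Gam (K + 2)) • tau h v := rfl

def tauCh (h : δ 0 = δ 1) (σ : Ch N δ L) : Ch N δ L :=
  ⟨fun m => tau h (σ.1 m), fun p => σ.2.1 _, fun m hm => by
    obtain ⟨p, ε, hε, hp, hw⟩ := σ.2.2.1 m hm
    refine ⟨(sw K p.1, p.2), ε, hε, ?_, ?_⟩
    · show Even ((σ.1 m).1 (sw K (sw K p.1), p.2))
      rw [sw_sw]; exact hp
    · funext q
      show (σ.1 (m + 1)).1 (sw K q.1, q.2) = _
      rw [hw]
      by_cases hq : q = (sw K p.1, p.2)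
      · rw [hq, Function.update_self]
        show Function.update (σ.1 m).1 p ((σ.1 m).1 p + ε) (sw K (sw K p.1), p.2) =
          (σ.1 m).1 (sw K (sw K p.1), p.2) + ε
        rw [sw_sw, Function.update_self]
      · rw [Function.update_of_ne hq, Function.update_of_ne]
        · rfl
        · intro h'
          apply hq
          rw [← h', sw_sw], fun m hm => congrArg (tau h) (σ.2.2.2 m hm)⟩

theorem tauCh_free (hδ : ∀ i, δ i < N) (hL : Even L) (h : δ 0 = δ 1) (hp : 1 ≤ δ 0)
    (g : Gam (K + 2)) (σ : Ch N δ L) : tauCh h σ ≠ g • σ := by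
  intro he
  have hpar : ∀ m a, Even ((σ.1 m).1 (0, a)) ↔ Even ((σ.1 m).1 (1, a)) := by
    intro m a
    have h1 := congrArg (fun s : Ch N δ L => (s.1 m).1 (0, a)) he
    have h2 : (σ.1 m).1 (sw K 0, a) = (g 0 : ℤ) * (σ.1 m).1 (0, a) := h1
    rw [show sw K 0 = 1 from Equiv.swap_apply_left 0 1] at h2
    rw [h2]
    rcases Int.units_eq_one_or (g 0) with h3 | h3 <;> rw [h3] <;> simp
  have hN := hδ 0
  have hodd : ∃ a, ¬ Even ((σ.1 (∑ i, δ i)).1 (0, a)) := by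
    by_contra hc
    push Not at hc
    have := uniq_even δ hδ hL (σ.1 (∑ i, δ i)).2 (σ.card _ le_rfl) 0 ⟨0, by omega⟩ ⟨1, by omega⟩
      (by simp) (by simpa using hp) (hc _) (hc _)
    simp at this
  obtain ⟨a, ha⟩ := hodd
  have hall : ∀ m ≤ ∑ i, δ i, Even ((σ.1 m).1 (0, a)) := by
    intro m
    induction m with
    | zero => intro _; exact σ.2.1 _
    | succ m ih =>
      intro hm
      have h0 := ih (by omega)
      have h1 := (hpar m a).1 h0
      obtain ⟨p, ε, hε, hpe, hw⟩ := σ.2.2.1 m (by omega)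
      by_cases hp0 : ((0 : Fin (K + 2)), a) = p
      · rw [hpar, hw, Function.update_of_ne]
        · exact h1
        · rw [← hp0]; intro h'; exact absurd (congrArg Prod.fst h') (by simp)
      · rw [hw, Function.update_of_ne hp0]
        exact h0
  exact ha (hall _ le_rfl)

/-- canonical representative up to sign and its code -/
noncomputable def can (x : Fin N → ℤ) : Fin N → ℤ := if lx x = 0 then x else fun a => - x a

noncomputable def rk (x : Fin N → ℤ) : ℕ := Encodable.encode (can x)

theorem rk_neg {x : Fin N → ℤ} (h : ∃ a, x a ≠ 0) : rk (fun a => - x a) = rk x := by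
  unfold rk
  congr 1
  unfold can
  rw [lx_neg h]
  generalize lx x = z
  by_cases hz : z = 0
  · subst hz; rw [if_neg (by decide)]; simp
  · rw [if_neg hz, if_pos]
    revert z; decide

theorem rk_inj {x y : Fin N → ℤ} (h : rk x = rk y) : (∀ a, x a = y a) ∨ (∀ a, x a = - y a) := by
  have := Encodable.encode_injective h
  unfold can at this
  split_ifs at this
  · left; exact congrFun this
  · right; exact congrFun this
  · right; intro a; have := congrFun this a; omega
  · left; intro a; have := congrFun this a; omega

noncomputable def rkv (i : Fin (K + 2)) (v : Vtx N δ L) : ℕ := rk (fun a => v.1 (i, a))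

theorem rkv_smul (hLp : 0 < L) (i : Fin (K + 2)) (g : Gam (K + 2)) (v : Vtx N δ L) :
    rkv i (g • v) = rkv i v := by
  unfold rkv
  simp only [smul_val]
  rcases Int.units_eq_one_or (g i) with h | h
  · simp [h]
  · rw [h, ← rk_neg (v.ex_ne hLp i)]; simp

def Diag (v : Vtx N δ L) : Prop :=
  (∀ a, v.1 (0, a) = v.1 (1, a)) ∨ (∀ a, v.1 (0, a) = - v.1 (1, a))

noncomputable def s00 (v : Vtx N δ L) : ZMod 2 := if rkv 0 v < rkv 1 v then 1 else 0

theorem rkv_tau0 (h : δ 0 = δ 1) (v : Vtx N δ L) : rkv 0 (tau h v) = rkv 1 v := by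
  show rk (fun a => v.1 (sw K 0, a)) = _
  rw [show sw K 0 = 1 from Equiv.swap_apply_left 0 1]; rfl
theorem rkv_tau1 (h : δ 0 = δ 1) (v : Vtx N δ L) : rkv 1 (tau h v) = rkv 0 v := by
  show rk (fun a => v.1 (sw K 1, a)) = _
  rw [show sw K 1 = 0 from Equiv.swap_apply_right 0 1]; rfl
theorem lxv_tau1 (h : δ 0 = δ 1) (v : Vtx N δ L) : lxv 1 (tau h v) = lxv 0 v := by
  show lx (fun a => v.1 (sw K 1, a)) = _
  rw [show sw K 1 = 0 from Equiv.swap_apply_right 0 1]; rfl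
theorem lxv_tau0 (h : δ 0 = δ 1) (v : Vtx N δ L) : lxv 0 (tau h v) = lxv 1 v := by
  show lx (fun a => v.1 (sw K 0, a)) = _
  rw [show sw K 0 = 1 from Equiv.swap_apply_left 0 1]; rfl

theorem s00_tau (h : δ 0 = δ 1) (v : Vtx N δ L) (hv : ¬ Diag v) : s00 (tau h v) = 1 + s00 v := by
  unfold s00
  rw [rkv_tau0, rkv_tau1]
  have : rkv 0 v ≠ rkv 1 v := fun he => hv (rk_inj he)
  by_cases h1 : rkv 0 v < rkv 1 v
  · rw [if_pos h1, if_neg (by omega)]; rfl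
  · rw [if_neg h1, if_pos (by omega)]; rfl

noncomputable def rho (S : Vtx N δ L → ZMod 2) (v : Vtx N δ L) : ZMod 2 :=
  if rkv 0 v ≤ rkv 1 v then lxv 0 v else S v + lxv 1 v

theorem rho_smul (hLp : 0 < L) (S : Vtx N δ L → ZMod 2)
    (hS : ∀ (g : Gam (K + 2)) v, S (g • v) = S v + chis {0, 1} g) (g : Gam (K + 2)) (v : Vtx N δ L) :
    rho S (g • v) = rho S v + chis {0} g := by
  unfold rho
  rw [rkv_smul hLp, rkv_smul hLp]
  split_ifs
  · rw [lxv_smul hLp]; simp [chis]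
  · rw [hS, lxv_smul hLp]
    have : chis {0, 1} g = chi 0 g + chi 1 g := by simp [chis]
    rw [this]
    simp only [chis, Finset.sum_singleton]
    generalize S v = x
    generalize lxv 1 v = y
    generalize chi 0 g = z
    generalize chi 1 g = w
    revert x y z w; decide

theorem rho_tau (h : δ 0 = δ 1) (S : Vtx N δ L → ZMod 2) (hS : ∀ v, S (tau h v) = S v)
    (v : Vtx N δ L) (hv : ¬ Diag v) : rho S (tau h v) = rho S v + S v := by
  unfold rho
  rw [rkv_tau0, rkv_tau1, lxv_tau0, lxv_tau1, hS]
  have : rkv 0 v ≠ rkv 1 v := fun he => hv (rk_inj he)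
  by_cases h1 : rkv 0 v ≤ rkv 1 v
  · rw [if_pos h1, if_neg (by omega)]; ring
  · rw [if_neg h1, if_pos (by omega)]
    generalize S v = x
    generalize lxv 1 v = y
    revert x y; decide

theorem s00_smul (hLp : 0 < L) (g : Gam (K + 2)) (v : Vtx N δ L) : s00 (g • v) = s00 v := by
  unfold s00; rw [rkv_smul hLp, rkv_smul hLp]

def ts (α : Finset (Fin (K + 2))) : Finset (Fin (K + 2)) := α.map (sw K).toEmbedding

theorem mem_ts (α : Finset (Fin (K + 2))) (i) : i ∈ ts α ↔ sw K i ∈ α := by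
  unfold ts
  rw [Finset.mem_map_equiv]
  rfl

theorem ts_ts (α : Finset (Fin (K + 2))) : ts (ts α) = α := by
  ext i; rw [mem_ts, mem_ts, sw_sw]

theorem ts_eq (α : Finset (Fin (K + 2))) (h : 0 ∈ α ↔ 1 ∈ α) : ts α = α := by
  ext i
  rw [mem_ts]
  by_cases h0 : i = 0
  · subst h0; rw [show sw K 0 = 1 from Equiv.swap_apply_left 0 1]; exact h.symm
  · by_cases h1 : i = 1
    · subst h1; rw [show sw K 1 = 0 from Equiv.swap_apply_right 0 1]; exact h
    · unfold sw
      rw [Equiv.swap_apply_of_ne_of_ne h0 h1]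

theorem zero_mem_ts (α : Finset (Fin (K + 2))) : 0 ∈ ts α ↔ 1 ∈ α := by
  rw [mem_ts, show sw K 0 = 1 from Equiv.swap_apply_left 0 1]
theorem one_mem_ts (α : Finset (Fin (K + 2))) : 1 ∈ ts α ↔ 0 ∈ α := by
  rw [mem_ts, show sw K 1 = 0 from Equiv.swap_apply_right 0 1]

end Tau

section Comb
variable {K n N : ℕ} {L : ℤ}

def FF (K J : ℕ) : Finset (Finset (Fin (K + 2)) × Fin J) := (Finset.univ.erase ∅) ×ˢ Finset.univ
def Sy (K J : ℕ) : Finset (Finset (Fin (K + 2)) × Fin J) := (FF K J).filter (fun p => (0 ∈ p.1 ↔ 1 ∈ p.1))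
def T1 (K J : ℕ) : Finset (Finset (Fin (K + 2)) × Fin J) :=
  (FF K J).filter (fun p => 0 ∈ p.1 ∧ 1 ∉ p.1)
def T2 (K J : ℕ) : Finset (Finset (Fin (K + 2)) × Fin J) :=
  (FF K J).filter (fun p => 1 ∈ p.1 ∧ 0 ∉ p.1)

theorem prod_split {M : Type*} [CommMonoid M] (J : ℕ) (A : Finset (Fin (K + 2)) → M) (m0 m1 : Fin J)
    (hm : m0 ≠ m1) :
    ∏ α ∈ (Finset.univ : Finset (Finset (Fin (K + 2)))).erase ∅, A α ^ J =
    A {0, 1} * ((∏ p ∈ ((Sy K J).erase ({0, 1}, m0)).erase ({0, 1}, m1), A p.1) *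
      ∏ p ∈ T1 K J, (A p.1 * A (ts p.1))) * A {0, 1} := by
  have e1 : ∏ α ∈ (Finset.univ : Finset (Finset (Fin (K + 2)))).erase ∅, A α ^ J =
      ∏ p ∈ FF K J, A p.1 := by
    unfold FF
    rw [Finset.prod_product]
    simp
  have e2 : FF K J = Sy K J ∪ (T1 K J ∪ T2 K J) := by
    ext p
    simp only [Sy, T1, T2, Finset.mem_union, Finset.mem_filter]
    tauto
  have hmem : ∀ m : Fin J, (({0, 1} : Finset (Fin (K + 2))), m) ∈ Sy K J := by
    intro m
    simp [Sy, FF]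
  have d1 : Disjoint (Sy K J) (T1 K J ∪ T2 K J) := by
    rw [Finset.disjoint_left]
    intro p hp
    simp only [Sy, T1, T2, Finset.mem_union, Finset.mem_filter] at hp ⊢
    tauto
  have d2 : Disjoint (T1 K J) (T2 K J) := by
    rw [Finset.disjoint_left]
    intro p hp
    simp only [T1, T2, Finset.mem_filter] at hp ⊢
    tauto
  have e3 : ∏ p ∈ T2 K J, A p.1 = ∏ p ∈ T1 K J, A (ts p.1) := by
    symm
    refine Finset.prod_bij (fun p _ => (ts p.1, p.2)) ?_ ?_ ?_ ?_
    · intro p hp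
      simp only [T1, T2, FF, Finset.mem_filter, Finset.mem_product, Finset.mem_erase, Finset.mem_univ,
        and_true, one_mem_ts, zero_mem_ts] at hp ⊢
      refine ⟨?_, hp.2⟩
      intro h
      have := (one_mem_ts p.1).2 hp.2.1
      rw [h] at this; simp at this
    · intro p _ q _ h
      have h1 := congrArg Prod.fst h
      have h2 := congrArg Prod.snd h
      simp only at h1 h2
      have := congrArg ts h1
      rw [ts_ts, ts_ts] at this
      exact Prod.ext this h2
    · intro p hp
      refine ⟨(ts p.1, p.2), ?_, by simp [ts_ts]⟩
      simp only [T1, T2, FF, Finset.mem_filter, Finset.mem_product, Finset.mem_erase, Finset.mem_univ,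
        and_true, one_mem_ts, zero_mem_ts] at hp ⊢
      refine ⟨?_, hp.2⟩
      intro h
      have := (zero_mem_ts p.1).2 hp.2.1
      rw [h] at this; simp at this
    · intro p _; rfl
  rw [e1, e2, Finset.prod_union d1, Finset.prod_union d2, e3, Finset.prod_mul_distrib,
    ← Finset.mul_prod_erase _ _ (hmem m0),
    ← Finset.mul_prod_erase ((Sy K J).erase ({0, 1}, m0)) _
      (Finset.mem_erase.2 ⟨fun h => hm (congrArg Prod.snd h).symm, hmem m1⟩)]
  generalize A {0, 1} = z
  ac_rfl

theorem ee_const1 {V : Type*} (s0 s1 s2 : V → ZMod 2) (v : ℕ → V) (h : ∀ a, s1 (v a) = s1 (v 0)) :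
    ee s0 s1 s2 v = 0 := by
  simp only [ee]
  rw [h 1, h 2, CharTwo.add_self_eq_zero]
  ring

theorem ee_const2 {V : Type*} (s0 s1 s2 : V → ZMod 2) (v : ℕ → V) (h : ∀ a, s2 (v a) = s2 (v 0)) :
    ee s0 s1 s2 v = 0 := by
  simp only [ee]
  rw [h 1, h 2, CharTwo.add_self_eq_zero]
  ring

theorem ee_swap {V : Type*} (s0 s1 s2 : V → ZMod 2) (v w : ℕ → V) (h0 : ∀ a, s0 (w a) = 1 + s0 (v a))
    (h1 : ∀ a, s1 (w a) = s2 (v a)) (h2 : ∀ a, s2 (w a) = s1 (v a)) :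
    ee s0 s1 s2 w = ee s0 s1 s2 v := by
  simp only [ee, h0, h1, h2]
  generalize s1 (v 0) + s1 (v 1) = a
  generalize s1 (v 1) + s1 (v 2) = b
  generalize s2 (v 0) + s2 (v 1) = c
  generalize s2 (v 1) + s2 (v 2) = e
  generalize s0 (v 0) = x
  generalize s0 (v 1) = y
  revert a b c e x y; decide

theorem d01 (K n : ℕ) : dlt K n 0 = dlt K n 1 := by simp [dlt]

theorem ghr_comb (hδ : ∀ i, dlt K n i < N) (hL : Even L) (hLp : 0 < L)
    (s : Finset (Fin (K + 2)) → Fin (2 ^ (n + 1)) → Vtx N (dlt K n) L → ZMod 2)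
    (hs : ∀ α m (g : Gam (K + 2)) v, s α m (g • v) = s α m v + chis α g)
    (hτ : ∀ α m v, s (ts α) m (tau (d01 K n) v) = s α m v)
    (m0 m1 : Fin (2 ^ (n + 1))) (hm : m0 ≠ m1)
    (hdg : ∀ σ : Ch N (dlt K n) L, (∃ a, Diag (σ.1 a)) → ∀ a, s {0, 1} m1 (σ.1 a) = s {0, 1} m1 (σ.1 0)) :
    ∃ σ : Ch N (dlt K n) L, ∀ α, α.Nonempty → ∀ m, ¬ ∀ a, s α m (σ.1 a) = s α m (σ.1 0) := by
  by_contra hcon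
  push Not at hcon
  set S := s {0, 1} m0 with hS
  have hτ' : ∀ α m v, (0 ∈ α ↔ 1 ∈ α) → s α m (tau (d01 K n) v) = s α m v := by
    intro α m v h
    conv_rhs => rw [← hτ α m v]
    rw [ts_eq α h]
  have h01 : ((0 : Fin (K + 2)) ∈ ({0, 1} : Finset (Fin (K + 2))) ↔ 1 ∈ ({0, 1} : Finset (Fin (K + 2)))) := by simp
  let iS : Finset (Fin (K + 2)) × Fin (2 ^ (n + 1)) → It N (dlt K n) L := fun p => itS hLp p.1 (s p.1 p.2) (hs p.1 p.2)
  let iP : Finset (Fin (K + 2)) × Fin (2 ^ (n + 1)) → It N (dlt K n) L := fun p =>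
    itP hLp p.1 (ts p.1) s00 (s p.1 p.2) (s (ts p.1) p.2) (s00_smul hLp) (hs p.1 p.2) (hs (ts p.1) p.2)
  let S' := ((Sy K (2 ^ (n + 1))).erase ({0, 1}, m0)).erase ({0, 1}, m1)
  let its : List (It N (dlt K n) L) := iS ({0, 1}, m1) :: (S'.toList.map iS ++ (T1 K (2 ^ (n + 1))).toList.map iP)
  obtain ⟨n', h1, h2⟩ := coh_list its 0 (dd (rho S)) [{0}] rfl (by
    rw [Wd_one]; exact Coh_dd (rho S) (lxs {0}) (chis {0}) (rho_smul hLp S (hs _ _)) (lxs_smul hLp _))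
  -- the word
  have hwp : ∀ {M : Type} [CommMonoid M] (A : Finset (Fin (K + 2)) → M), ((its.flatMap It.w).map A).prod =
      A {0, 1} * ((∏ p ∈ S', A p.1) * ∏ p ∈ T1 K (2 ^ (n + 1)), (A p.1 * A (ts p.1))) := by
    intro M _ A
    have gen : ∀ l : List (It N (dlt K n) L), ((l.flatMap It.w).map A).prod = (l.map (fun it => (it.w.map A).prod)).prod := by
      intro l
      induction l with
      | nil => simp
      | cons a l ih => simp [ih]
    rw [gen]
    simp only [its, List.map_cons, List.prod_cons, List.map_append, List.prod_append, List.map_map]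
    rw [← Finset.prod_map_toList S', ← Finset.prod_map_toList (T1 K (2 ^ (n + 1)))]
    congr 1
    · simp [iS, itS]
    congr 1
    · congr 1
      apply List.map_congr_left
      intro p _
      simp [iS, itS]
    · congr 1
      apply List.map_congr_left
      intro p _
      simp [iP, itP]
  -- the length
  have hlen : ([({0} : Finset (Fin (K + 2)))] ++ its.flatMap It.w).length = ∑ i, dlt K n i := by
    have e1 := prod_split (K := K) (2 ^ (n + 1)) (fun _ => Multiplicative.ofAdd 1) m0 m1 hm
    have e2 := hwp (fun _ => Multiplicative.ofAdd (1 : ℕ))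
    rw [← e2] at e1
    have e3 := congrArg Multiplicative.toAdd e1
    rw [List.map_const', List.prod_replicate, Finset.prod_const, Finset.card_erase_of_mem (Finset.mem_univ _)] at e3
    simp at e3
    rw [dlt_sum, List.length_append, List.length_singleton]
    simp only [List.length_flatMap] at e3 ⊢
    rw [mul_comm (2 ^ (n + 1)), e3]
    ring
  have hsum : ∑ i, dlt K n i = n' + 1 := by rw [← h1, hlen]
  have h4 := integ_coh hδ hL hLp n' hsum _ _ h2
  rw [eval_list hδ hL hLp (by omega) _ hlen] at h4
  rw [List.map_append, List.prod_append, hwp, mul_comm] at h4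
  have h5 := coeff_main K n (((∑ i ∈ ({0, 1} : Finset (Fin (K + 2))), MvPolynomial.X i) *
      ((∏ p ∈ S', ∑ i ∈ p.1, MvPolynomial.X i) *
      ∏ p ∈ T1 K (2 ^ (n + 1)), ((∑ i ∈ p.1, MvPolynomial.X i) * (∑ i ∈ ts p.1, MvPolynomial.X i))))) (by
    rw [prod_split (2 ^ (n + 1)) (fun α => ∑ i ∈ α, MvPolynomial.X i) m0 m1 hm]
    congr 1
    simp)
  simp only [List.map_cons, List.map_nil, List.prod_cons, List.prod_nil, mul_one, Finset.sum_singleton] at h4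
  rw [h5] at h4
  -- now the vanishing
  have hvan : ∀ σ : Ch N (dlt K n) L, dd S σ.1 * ZZ its (shift (0 + 1) σ.1) = 0 := by
    intro σ
    obtain ⟨α, hα, m, hc⟩ := hcon σ
    have hc' : ∀ a b, s α m (σ.1 a) = s α m (σ.1 b) := fun a b => by rw [hc a, hc b]
    have hFF : (α, m) ∈ FF K (2 ^ (n + 1)) := by
      simp [FF, hα.ne_empty]
    have hsing : ∀ q : Finset (Fin (K + 2)) × Fin (2 ^ (n + 1)), q = (α, m) → ∀ a, (iS q).c (shift a σ.1) = 0 := by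
      rintro q rfl a
      show dd (s α m) _ = 0
      simp only [dd, shift]
      rw [hc' (a + 0) (a + 1), CharTwo.add_self_eq_zero]
    by_cases hsy : (0 ∈ α ↔ 1 ∈ α)
    · by_cases e0 : (α, m) = ({0, 1}, m0)
      · have e1 : α = {0, 1} := congrArg Prod.fst e0
        have e2 : m = m0 := congrArg Prod.snd e0
        subst e1; subst e2
        simp only [dd, hS]
        rw [hc 1, CharTwo.add_self_eq_zero, zero_mul]
      · rw [ZZ_zero its σ.1 (iS (α, m)) ?_ (hsing _ rfl), mul_zero]
        by_cases e1 : (α, m) = ({0, 1}, m1)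
        · rw [e1]; exact List.mem_cons_self
        · apply List.mem_cons_of_mem
          apply List.mem_append_left
          apply List.mem_map_of_mem
          rw [Finset.mem_toList]
          exact Finset.mem_erase.2 ⟨e1, Finset.mem_erase.2 ⟨e0, Finset.mem_filter.2 ⟨hFF, hsy⟩⟩⟩
    · by_cases h0 : 0 ∈ α
      · rw [ZZ_zero its σ.1 (iP (α, m)) ?_ ?_, mul_zero]
        · apply List.mem_cons_of_mem
          apply List.mem_append_right
          apply List.mem_map_of_mem
          rw [Finset.mem_toList]
          exact Finset.mem_filter.2 ⟨hFF, h0, fun h => hsy ⟨fun _ => h, fun _ => h0⟩⟩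
        · intro a
          exact ee_const1 _ _ _ _ (fun b => hc' _ _)
      · have h1 : 1 ∈ α := by tauto
        rw [ZZ_zero its σ.1 (iP (ts α, m)) ?_ ?_, mul_zero]
        · apply List.mem_cons_of_mem
          apply List.mem_append_right
          apply List.mem_map_of_mem
          rw [Finset.mem_toList]
          refine Finset.mem_filter.2 ⟨?_, (zero_mem_ts α).2 h1, fun h => h0 ((one_mem_ts α).1 h)⟩
          have : ts α ≠ ∅ := fun h => by
            have h' := (zero_mem_ts α).2 h1
            rw [h] at h'; simp at h'
          simp [FF, this]
        · intro a
          refine ee_const2 _ _ _ _ (fun b => ?_)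
          show s (ts (ts α)) m _ = s (ts (ts α)) m _
          rw [ts_ts]
          exact hc' _ _
  have hinv : ∀ σ : Ch N (dlt K n) L,
      dd (rho S) (tauCh (d01 K n) σ).1 * ZZ its (shift (0 + 1) (tauCh (d01 K n) σ).1) =
      dd (rho S) σ.1 * ZZ its (shift (0 + 1) σ.1) := by
    intro σ
    by_cases hD : ∃ a, Diag (σ.1 a)
    · have hc := hdg σ hD
      have hc' : ∀ a b, s {0, 1} m1 (σ.1 a) = s {0, 1} m1 (σ.1 b) := fun a b => by rw [hc a, hc b]
      rw [ZZ_zero its σ.1 (iS ({0, 1}, m1)) List.mem_cons_self ?_,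
        ZZ_zero its (tauCh (d01 K n) σ).1 (iS ({0, 1}, m1)) List.mem_cons_self ?_, mul_zero, mul_zero]
      · intro a
        show s {0, 1} m1 (tau (d01 K n) (σ.1 (a + 0))) + s {0, 1} m1 (tau (d01 K n) (σ.1 (a + 1))) = 0
        rw [hτ' _ _ _ h01, hτ' _ _ _ h01, hc' (a + 0) (a + 1), CharTwo.add_self_eq_zero]
      · intro a
        show s {0, 1} m1 (σ.1 (a + 0)) + s {0, 1} m1 (σ.1 (a + 1)) = 0
        rw [hc' (a + 0) (a + 1), CharTwo.add_self_eq_zero]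
    · push Not at hD
      have e1 : ZZ its (shift (0 + 1) (tauCh (d01 K n) σ).1) = ZZ its (shift (0 + 1) σ.1) := by
        apply ZZ_congr
        have hsing : ∀ q : Finset (Fin (K + 2)) × Fin (2 ^ (n + 1)), (0 ∈ q.1 ↔ 1 ∈ q.1) → ∀ a,
            (iS q).c (shift a (tauCh (d01 K n) σ).1) = (iS q).c (shift a σ.1) := by
          intro q hq a
          show s q.1 q.2 (tau (d01 K n) (σ.1 (a + 0))) + s q.1 q.2 (tau (d01 K n) (σ.1 (a + 1))) =
            s q.1 q.2 (σ.1 (a + 0)) + s q.1 q.2 (σ.1 (a + 1))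
          rw [hτ' _ _ _ hq, hτ' _ _ _ hq]
        intro it hit a
        rcases List.mem_cons.1 hit with rfl | hit
        · exact hsing _ h01 a
        rcases List.mem_append.1 hit with hit | hit
        · obtain ⟨q, hq, rfl⟩ := List.mem_map.1 hit
          rw [Finset.mem_toList] at hq
          have := Finset.mem_of_mem_erase (Finset.mem_of_mem_erase hq)
          exact hsing _ (Finset.mem_filter.1 this).2 a
        · obtain ⟨q, hq, rfl⟩ := List.mem_map.1 hit
          refine ee_swap s00 (s q.1 q.2) (s (ts q.1) q.2) _ _ ?_ ?_ ?_
          · intro b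
            exact s00_tau (d01 K n) _ (hD _)
          · intro b
            have := hτ (ts q.1) q.2 (σ.1 (a + b))
            rw [ts_ts] at this
            exact this
          · intro b
            exact hτ q.1 q.2 (σ.1 (a + b))
      rw [e1]
      have e2 : dd (rho S) (tauCh (d01 K n) σ).1 = dd (rho S) σ.1 + dd S σ.1 := by
        show rho S (tau (d01 K n) (σ.1 0)) + rho S (tau (d01 K n) (σ.1 1)) =
          rho S (σ.1 0) + rho S (σ.1 1) + (S (σ.1 0) + S (σ.1 1))
        rw [rho_tau _ S (fun v => hτ' _ _ v h01) _ (hD 0), rho_tau _ S (fun v => hτ' _ _ v h01) _ (hD 1)]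
        ring
      rw [e2, add_mul, hvan, add_zero]
  rw [integ_invol (tauCh (d01 K n))] at h4
  · exact absurd h4 (by decide)
  · intro g σ
    exact h2.inv g σ.1
  · intro g σ
    exact ⟨fun i => g (sw K i), Subtype.ext (funext fun m => tau_smul (d01 K n) g (σ.1 m))⟩
  · intro σ
    exact Subtype.ext (funext fun m => tau_tau (d01 K n) (σ.1 m))
  · intro g σ
    exact tauCh_free hδ hL (d01 K n) (by simp [dlt]; have : 0 < 2 ^ n := by positivity
                                         have h2 : 0 < 2 ^ (n + K + 1) := by positivity
                                         omega) g σ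
  · exact hinv

end Comb
end GHR

namespace GHR
open Filter Topology

section Top
variable {k N : ℕ} {δ : Fin k → ℕ} {L : ℤ}

def YY (N : ℕ) (δ : Fin k → ℕ) : Set (Fin k → Fin N → ℝ) :=
  {x | ∀ i, ‖x i‖ = 1 ∧ ∀ a, δ i < a.1 → x i a = 0}

theorem YY_compact : IsCompact (YY N δ) := by
  apply Metric.isCompact_of_isClosed_isBounded
  · have : YY N δ = ⋂ i, ({x : Fin k → Fin N → ℝ | ‖x i‖ = 1} ∩ ⋂ a, ⋂ (_ : δ i < a.1), {x | x i a = 0}) := by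
      ext x; simp [YY]
    rw [this]
    apply isClosed_iInter
    intro i
    apply IsClosed.inter
    · exact isClosed_eq (by fun_prop) (by fun_prop)
    · apply isClosed_iInter
      intro a
      apply isClosed_iInter
      intro _
      exact isClosed_eq (by fun_prop) (by fun_prop)
  · apply (Metric.isBounded_closedBall (x := (0 : Fin k → Fin N → ℝ)) (r := 1)).subset
    intro x hx
    rw [mem_closedBall_zero_iff, pi_norm_le_iff_of_nonneg zero_le_one]
    intro i
    exact (hx i).1.le

noncomputable def pt (v : Vtx N δ L) : Fin k → Fin N → ℝ := fun i a => (v.1 (i, a) : ℝ) / L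

theorem pt_mem (hLp : 0 < L) (v : Vtx N δ L) : pt v ∈ YY N δ := by
  intro i
  have hL : (0 : ℝ) < L := by exact_mod_cast hLp
  obtain ⟨h1, ⟨a, ha⟩, h3⟩ := v.2 i
  have e : ∀ a, ‖pt v i a‖ = ((|v.1 (i, a)| : ℤ) : ℝ) / L := by
    intro a
    unfold pt
    rw [Real.norm_eq_abs, abs_div, abs_of_pos hL, Int.cast_abs]
  refine ⟨?_, ?_⟩
  · apply le_antisymm
    · rw [pi_norm_le_iff_of_nonneg zero_le_one]
      intro b
      rw [e, div_le_one hL]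
      exact_mod_cast h1 b
    · have := norm_le_pi_norm (pt v i) a
      rw [e, ha, div_self hL.ne'] at this
      exact this
  · intro b hb
    unfold pt
    rw [h3 b hb]; simp

theorem pt_smul (g : Gam k) (v : Vtx N δ L) :
    pt (g • v) = fun i a => (((g i : ℤˣ) : ℤ) : ℝ) * pt v i a := by
  funext i a
  unfold pt
  rw [smul_val]
  push_cast
  ring

theorem chain_close (hLp : 0 < L) (σ : Ch N δ L) (a : ℕ) :
    dist (pt (σ.1 a)) (pt (σ.1 0)) ≤ (∑ i, δ i : ℕ) / (L : ℝ) := by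
  have hL : (0 : ℝ) < L := by exact_mod_cast hLp
  have hstep : ∀ m < ∑ i, δ i, dist (pt (σ.1 (m + 1))) (pt (σ.1 m)) ≤ 1 / (L : ℝ) := by
    intro m hm
    obtain ⟨p, ε, hε, hp, hw⟩ := σ.2.2.1 m hm
    rw [dist_pi_le_iff (by positivity)]
    intro i
    rw [dist_pi_le_iff (by positivity)]
    intro b
    unfold pt
    rw [Real.dist_eq, ← sub_div, abs_div, abs_of_pos hL]
    apply div_le_div_of_nonneg_right _ hL.le
    rw [hw]
    by_cases hq : (i, b) = p
    · rw [hq, Function.update_self]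
      rcases hε with h | h <;> rw [h] <;> simp
    · rw [Function.update_of_ne hq]; simp
  have hind : ∀ m ≤ ∑ i, δ i, dist (pt (σ.1 m)) (pt (σ.1 0)) ≤ (m : ℝ) / L := by
    intro m
    induction m with
    | zero => intro _; simp
    | succ m ih =>
      intro hm
      have h1 := dist_triangle (pt (σ.1 (m + 1))) (pt (σ.1 m)) (pt (σ.1 0))
      have h2 := ih (by omega)
      have h3 := hstep m (by omega)
      push_cast
      rw [add_div]
      linarith
  by_cases ha : a ≤ ∑ i, δ i
  · apply (hind a ha).trans
    apply div_le_div_of_nonneg_right _ hL.le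
    exact_mod_cast ha
  · rw [σ.2.2.2 a (by omega)]
    exact hind _ le_rfl

theorem lim_core {X ι : Type*} [MetricSpace X] {Y : Set X} (hY : IsCompact Y) (f : ι → X → ℝ)
    (hf : ∀ i, ContinuousOn (f i) Y) (x : ℕ → X) (hx : ∀ l, x l ∈ Y) (y z : ι → ℕ → X)
    (hy : ∀ i l, y i l ∈ Y) (hz : ∀ i l, z i l ∈ Y)
    (hyx : ∀ i, Tendsto (fun l => dist (y i l) (x l)) atTop (𝓝 0))
    (hzx : ∀ i, Tendsto (fun l => dist (z i l) (x l)) atTop (𝓝 0))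
    (h1 : ∀ i l, 0 ≤ f i (y i l)) (h2 : ∀ i l, f i (z i l) ≤ 0) :
    ∃ p ∈ Y, (∃ φ : ℕ → ℕ, StrictMono φ ∧ Tendsto (x ∘ φ) atTop (𝓝 p)) ∧ ∀ i, f i p = 0 := by
  obtain ⟨p, hp, φ, hφ, hlim⟩ := hY.tendsto_subseq hx
  refine ⟨p, hp, ⟨φ, hφ, hlim⟩, fun i => ?_⟩
  have key : ∀ w : ℕ → X, (∀ l, w l ∈ Y) → Tendsto (fun l => dist (w l) (x l)) atTop (𝓝 0) →
      Tendsto (fun l => f i (w (φ l))) atTop (𝓝 (f i p)) := by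
    intro w hw hwx
    have t1 : Tendsto (fun l => w (φ l)) atTop (𝓝 p) := by
      have t2 := hwx.comp hφ.tendsto_atTop
      exact (tendsto_iff_of_dist (f₁ := fun l => w (φ l)) (f₂ := x ∘ φ) t2).2 hlim
    have t3 : Tendsto (fun l => w (φ l)) atTop (𝓝[Y] p) :=
      tendsto_nhdsWithin_iff.2 ⟨t1, Eventually.of_forall fun l => hw _⟩
    exact (hf i p hp).tendsto.comp t3
  apply le_antisymm
  · exact le_of_tendsto' (key _ (hz i) (hzx i)) (fun l => h2 i _)
  · exact ge_of_tendsto' (key _ (hy i) (hyx i)) (fun l => h1 i _)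

open Classical in
noncomputable def sg (α : Finset (Fin k)) (f : (Fin k → Fin N → ℝ) → ℝ) (v : Vtx N δ L) : ZMod 2 :=
  if 0 < f (pt v) then 0 else if f (pt v) < 0 then 1 else lxs α v

theorem prod_chis (α : Finset (Fin k)) (g : Gam k) :
    ∏ i ∈ α, (((g i : ℤˣ) : ℤ) : ℝ) = if chis α g = 0 then 1 else -1 := by
  induction α using Finset.induction_on with
  | empty => simp [chis]
  | insert i α hi ih =>
    rw [Finset.prod_insert hi, ih]
    have : chis (insert i α) g = chi i g + chis α g := by unfold chis; rw [Finset.sum_insert hi]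
    rw [this]
    generalize chis α g = z
    unfold chi
    rcases Int.units_eq_one_or (g i) with h | h
    · rw [h]; simp
    · rw [h]
      have : z = 0 ∨ z = 1 := by revert z; decide
      rcases this with rfl | rfl <;> simp
      decide

theorem sg_smul (hLp : 0 < L) (α : Finset (Fin k)) (f : (Fin k → Fin N → ℝ) → ℝ)
    (hf : ∀ (g : Gam k), ∀ x ∈ YY N δ, f (fun i a => (((g i : ℤˣ) : ℤ) : ℝ) * x i a) =
      (∏ i ∈ α, (((g i : ℤˣ) : ℤ) : ℝ)) * f x) (g : Gam k) (v : Vtx N δ L) :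
    sg α f (g • v) = sg α f v + chis α g := by
  unfold sg
  rw [pt_smul, hf g _ (pt_mem hLp v), prod_chis, lxs_smul hLp]
  have : chis α g = 0 ∨ chis α g = 1 := by generalize chis α g = z; revert z; decide
  rcases this with h | h <;> rw [h]
  · simp
  · rcases lt_trichotomy (f (pt v)) 0 with h1 | h1 | h1
    · simp [h1, h1.le, h1.not_gt]; rfl
    · simp [h1]
    · simp [h1, h1.le, h1.not_gt]

theorem sg_nonconst {α : Finset (Fin k)} {f : (Fin k → Fin N → ℝ) → ℝ} {σ : ℕ → Vtx N δ L}
    (h : ¬ ∀ a, sg α f (σ a) = sg α f (σ 0)) :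
    (∃ a, 0 ≤ f (pt (σ a))) ∧ ∃ b, f (pt (σ b)) ≤ 0 := by
  constructor
  · by_contra hc
    push Not at hc
    apply h
    intro a
    unfold sg
    simp [hc, (hc _).not_gt]
  · by_contra hc
    push Not at hc
    apply h
    intro a
    unfold sg
    simp [hc]

theorem LL_lim (C : ℝ) : Tendsto (fun l : ℕ => C / (((2 * (l + 1) : ℕ) : ℤ) : ℝ)) atTop (𝓝 0) := by
  apply Tendsto.div_atTop tendsto_const_nhds
  have : (fun l : ℕ => (((2 * (l + 1) : ℕ) : ℤ) : ℝ)) = fun l : ℕ => ((2 * (l + 1) : ℕ) : ℝ) := by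
    funext l; push_cast; ring
  rw [this]
  apply tendsto_natCast_atTop_atTop.comp
  apply tendsto_atTop_mono (fun l => (by omega : l ≤ 2 * (l + 1))) tendsto_id

/-- from chains with sign changes for a cofinal sequence of scales to a common zero -/
theorem chains_zero {ι : Type*} (α : ι → Finset (Fin k)) (f : ι → (Fin k → Fin N → ℝ) → ℝ)
    (hf : ∀ i, ContinuousOn (f i) (YY N δ)) (φ : ℕ → ℕ) (hφ : StrictMono φ)
    (σ : ∀ l, Ch N δ ((2 * (φ l + 1) : ℕ) : ℤ)) (a : ℕ → ℕ)
    (h : ∀ l i, ¬ ∀ b, sg (α i) (f i) ((σ l).1 b) = sg (α i) (f i) ((σ l).1 0)) :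
    ∃ p ∈ YY N δ, (∃ ψ : ℕ → ℕ, StrictMono ψ ∧
      Tendsto (fun l => pt ((σ (ψ l)).1 (a (ψ l)))) atTop (𝓝 p)) ∧ ∀ i, f i p = 0 := by
  choose y hy using fun i l => (sg_nonconst (h l i)).1
  choose z hz using fun i l => (sg_nonconst (h l i)).2
  have hp : ∀ l : ℕ, (0 : ℤ) < ((2 * (φ l + 1) : ℕ) : ℤ) := fun l => by positivity
  have hd : ∀ w : ℕ → ℕ, Tendsto (fun l => dist (pt ((σ l).1 (w l))) (pt ((σ l).1 (a l)))) atTop (𝓝 0) := by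
    intro w
    have t := (LL_lim (2 * ((∑ i, δ i : ℕ) : ℝ))).comp hφ.tendsto_atTop
    refine squeeze_zero (fun _ => dist_nonneg) (fun l => ?_) t
    have h1 := chain_close (hp l) (σ l) (w l)
    have h2 := chain_close (hp l) (σ l) (a l)
    have h3 := dist_triangle_right (pt ((σ l).1 (w l))) (pt ((σ l).1 (a l))) (pt ((σ l).1 0))
    simp only [Function.comp]
    rw [mul_div_assoc]
    linarith
  obtain ⟨p, hpY, ⟨ψ, hψ, hl⟩, h0⟩ := lim_core YY_compact f hf (fun l => pt ((σ l).1 (a l)))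
    (fun l => pt_mem (hp l) _)
    (fun i l => pt ((σ l).1 (y i l))) (fun i l => pt ((σ l).1 (z i l)))
    (fun i l => pt_mem (hp l) _) (fun i l => pt_mem (hp l) _) (fun i => hd _) (fun i => hd _) hy hz
  exact ⟨p, hpY, ⟨ψ, hψ, hl⟩, h0⟩

theorem bu_top (hδ : ∀ i, δ i < N) (hk : 0 < k) (d : ℕ) (hd : ∑ i, δ i = d + 1)
    (α : Fin (d + 1) → Finset (Fin k)) (f : Fin (d + 1) → (Fin k → Fin N → ℝ) → ℝ)
    (hf : ∀ i, ContinuousOn (f i) (YY N δ))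
    (hg : ∀ m (g : Gam k), ∀ x ∈ YY N δ, f m (fun i a => (((g i : ℤˣ) : ℤ) : ℝ) * x i a) =
      (∏ i ∈ α m, (((g i : ℤˣ) : ℤ) : ℝ)) * f m x)
    (hc : MvPolynomial.coeff (Finsupp.equivFunOnFinite.symm δ)
      (∏ m, ∑ i ∈ α m, (MvPolynomial.X i : MvPolynomial (Fin k) (ZMod 2))) ≠ 0) :
    ∃ p ∈ YY N δ, ∀ m, f m p = 0 := by
  have hp : ∀ l : ℕ, (0 : ℤ) < ((2 * (l + 1) : ℕ) : ℤ) := fun l => by positivity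
  have he : ∀ l : ℕ, Even (((2 * (l + 1) : ℕ) : ℤ)) := fun l => by push_cast; exact even_two_mul _
  choose σ hσ using fun l : ℕ => bu_comb hδ (he l) (hp l) hk d hd α (fun m => sg (α m) (f m))
    (fun m => sg_smul (hp l) (α m) (f m) (hg m)) hc
  obtain ⟨p, h1, _, h2⟩ := chains_zero α f hf id strictMono_id σ (fun _ => 0) hσ
  exact ⟨p, h1, h2⟩

end Top

section Top2
variable {K n N : ℕ}

theorem lxs_tau {δ : Fin (K + 2) → ℕ} {L : ℤ} (h : δ 0 = δ 1) (α : Finset (Fin (K + 2))) (v : Vtx N δ L) :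
    lxs (ts α) (tau h v) = lxs α v := by
  unfold lxs ts
  rw [Finset.sum_map]
  apply Finset.sum_congr rfl
  intro i _
  show lx (fun a => v.1 (sw K (sw K i), a)) = _
  rw [sw_sw]; rfl

theorem ghr_top (hδ : ∀ i, dlt K n i < N)
    (f : Finset (Fin (K + 2)) → Fin (2 ^ (n + 1)) → (Fin (K + 2) → Fin N → ℝ) → ℝ)
    (hf : ∀ α m, ContinuousOn (f α m) (YY N (dlt K n)))
    (hg : ∀ α m (g : Gam (K + 2)), ∀ x ∈ YY N (dlt K n),
      f α m (fun i a => (((g i : ℤˣ) : ℤ) : ℝ) * x i a) = (∏ i ∈ α, (((g i : ℤˣ) : ℤ) : ℝ)) * f α m x)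
    (hτ : ∀ α m x, x ∈ YY N (dlt K n) → f (ts α) m (fun i => x (sw K i)) = f α m x)
    (m0 m1 : Fin (2 ^ (n + 1))) (hm : m0 ≠ m1)
    (hdg : ∀ x ∈ YY N (dlt K n), (x 0 = x 1 ∨ x 0 = - x 1) → f {0, 1} m1 x ≠ 0) :
    ∃ p ∈ YY N (dlt K n), ∀ α, α.Nonempty → ∀ m, f α m p = 0 := by
  have hp : ∀ l : ℕ, (0 : ℤ) < ((2 * (l + 1) : ℕ) : ℤ) := fun l => by positivity
  have he : ∀ l : ℕ, Even (((2 * (l + 1) : ℕ) : ℤ)) := fun l => by push_cast; exact even_two_mul _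
  have hev : ∀ᶠ l : ℕ in atTop, ∀ σ : Ch N (dlt K n) ((2 * (l + 1) : ℕ) : ℤ), (∃ a, Diag (σ.1 a)) →
      ∀ a, sg {0, 1} (f {0, 1} m1) (σ.1 a) = sg {0, 1} (f {0, 1} m1) (σ.1 0) := by
    by_contra hc
    obtain ⟨φ, hφ, hbad⟩ := extraction_of_frequently_atTop (not_eventually.1 hc)
    have hbad' : ∀ l, ∃ σ : Ch N (dlt K n) ((2 * (φ l + 1) : ℕ) : ℤ), (∃ a, Diag (σ.1 a)) ∧
      ¬ ∀ a, sg {0, 1} (f {0, 1} m1) (σ.1 a) = sg {0, 1} (f {0, 1} m1) (σ.1 0) := by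
      intro l
      have := hbad l
      push Not at this ⊢
      exact this
    choose σ hD hσ using hbad'
    choose a ha using hD
    obtain ⟨p, h1, ⟨ψ, hψ, hl⟩, h2⟩ := chains_zero (ι := Unit) (fun _ => {0, 1}) (fun _ => f {0, 1} m1)
      (fun _ => hf _ _) φ hφ σ a (fun l _ => hσ l)
    refine hdg p h1 ?_ (h2 ())
    have hcl : IsClosed {x : Fin (K + 2) → Fin N → ℝ | x 0 = x 1 ∨ x 0 = - x 1} :=
      (isClosed_eq (by fun_prop) (by fun_prop)).union (isClosed_eq (by fun_prop) (by fun_prop))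
    refine hcl.mem_of_tendsto hl (Eventually.of_forall fun l => ?_)
    rcases ha (ψ l) with h | h
    · left; funext b; simp only [pt, h b]
    · right; funext b; simp only [pt, h b, Pi.neg_apply]; push_cast; ring
  obtain ⟨l0, hl0⟩ := eventually_atTop.1 hev
  have hex : ∀ l : ℕ, ∃ σ : Ch N (dlt K n) ((2 * ((l + l0) + 1) : ℕ) : ℤ), ∀ α, α.Nonempty → ∀ m,
      ¬ ∀ a, sg α (f α m) (σ.1 a) = sg α (f α m) (σ.1 0) := by
    intro l
    refine ghr_comb hδ (he _) (hp _) (fun α m => sg α (f α m)) (fun α m => sg_smul (hp _) α _ (hg α m)) ?_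
      m0 m1 hm (hl0 _ (by omega))
    intro α m v
    unfold sg
    rw [lxs_tau]
    have : pt (tau (d01 K n) v) = fun i => pt v (sw K i) := rfl
    rw [this, hτ α m _ (pt_mem (hp _) v)]
  choose σ hσ using hex
  obtain ⟨p, h1, _, h2⟩ := chains_zero
    (ι := {α : Finset (Fin (K + 2)) // α.Nonempty} × Fin (2 ^ (n + 1))) (fun q => q.1.1)
    (fun q => f q.1.1 q.2) (fun _ => hf _ _) (fun l => l + l0) (strictMono_id.add_const l0) σ (fun _ => 0)
    (fun l q => hσ l q.1.1 q.1.2 q.2)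
  exact ⟨p, h1, fun α hα m => h2 (⟨α, hα⟩, m)⟩

end Top2
end GHR

namespace GHR
open Filter Topology

section Meas
variable {k d : ℕ}

noncomputable def ev (w : Fin (d + 1) → ℝ) (x : Fin d → ℝ) : ℝ := ∑ a, w a.castSucc * x a + w (Fin.last d)

noncomputable def aff (w : Fin (d + 1) → ℝ) : (Fin d → ℝ) →ᵃ[ℝ] ℝ where
  toFun := ev w
  linear := ∑ a, w a.castSucc • LinearMap.proj a
  map_vadd' p v := by
    simp only [ev, vadd_eq_add, Pi.add_apply, LinearMap.sum_apply, LinearMap.smul_apply,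
      LinearMap.proj_apply, smul_eq_mul, mul_add, Finset.sum_add_distrib]
    ring

theorem aff_apply (w : Fin (d + 1) → ℝ) (x) : aff w x = ev w x := rfl

theorem aff_linear (w : Fin (d + 1) → ℝ) (h : (aff w).linear = 0) (a : Fin d) : w a.castSucc = 0 := by
  have h1 := congrArg (fun l : (Fin d → ℝ) →ₗ[ℝ] ℝ => l (Pi.single a 1)) h
  have h2 : ∑ b, w b.castSucc * (Pi.single a (1 : ℝ) : Fin d → ℝ) b = 0 := by
    simpa [aff, LinearMap.sum_apply] using h1
  simpa [Pi.single_apply] using h2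

theorem ev_cont : Continuous (fun q : (Fin (d + 1) → ℝ) × (Fin d → ℝ) => ev q.1 q.2) := by
  unfold ev; fun_prop

theorem ev_cont_left (x : Fin d → ℝ) : Continuous (fun w : Fin (d + 1) → ℝ => ev w x) := by
  unfold ev; fun_prop

theorem ev_cont_right (w : Fin (d + 1) → ℝ) : Continuous (ev w) := by
  unfold ev; fun_prop

theorem ev_null {μ : Measure (Fin d → ℝ)} (hμ : IsMass μ) (w : Fin (d + 1) → ℝ) (hw : w ≠ 0) :
    ∀ᵐ x ∂μ, ev w x ≠ 0 := by
  by_cases hl : (aff w).linear = 0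
  · apply Eventually.of_forall
    intro x hx
    apply hw
    have h0 := aff_linear w hl
    unfold ev at hx
    simp only [h0, zero_mul, Finset.sum_const_zero, zero_add] at hx
    funext a
    refine Fin.lastCases ?_ (fun b => ?_) a
    · exact hx
    · exact h0 b
  · have := hμ.2 (aff w) hl
    rw [ae_iff]
    simpa [aff_apply] using this

theorem sign_meas : Measurable Real.sign := by
  unfold Real.sign
  apply Measurable.ite (measurableSet_lt measurable_id measurable_const) measurable_const
  exact Measurable.ite (measurableSet_lt measurable_const measurable_id) measurable_const measurable_const

theorem sign_cont {t : ℝ} (h : t ≠ 0) : ContinuousAt Real.sign t := by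
  rcases lt_or_gt_of_ne h with h | h
  · apply (continuousAt_const (y := (-1 : ℝ))).congr
    filter_upwards [Iio_mem_nhds h] with s hs
    exact (Real.sign_of_neg hs).symm
  · apply (continuousAt_const (y := (1 : ℝ))).congr
    filter_upwards [Ioi_mem_nhds h] with s hs
    exact (Real.sign_of_pos hs).symm

theorem sign_abs_le (t : ℝ) : |Real.sign t| ≤ 1 := by
  rcases Real.sign_apply_eq t with h | h | h <;> rw [h] <;> simp

noncomputable def sp (α : Finset (Fin k)) (y : Fin k → Fin (d + 1) → ℝ) (x : Fin d → ℝ) : ℝ :=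
  ∏ i ∈ α, Real.sign (ev (y i) x)

theorem sp_meas (α : Finset (Fin k)) (y : Fin k → Fin (d + 1) → ℝ) : Measurable (sp α y) := by
  unfold sp
  apply Finset.measurable_prod
  intro i _
  exact sign_meas.comp (ev_cont_right _).measurable

theorem sp_le (α : Finset (Fin k)) (y : Fin k → Fin (d + 1) → ℝ) (x) : ‖sp α y x‖ ≤ 1 := by
  unfold sp
  rw [norm_prod]
  apply Finset.prod_le_one
  · intro i _; exact norm_nonneg _
  · intro i _; exact sign_abs_le _

theorem sp_int (μ : Measure (Fin d → ℝ)) [IsFiniteMeasure μ] (α : Finset (Fin k)) (y : Fin k → Fin (d + 1) → ℝ) :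
    Integrable (sp α y) μ :=
  Integrable.of_bound (sp_meas α y).aestronglyMeasurable 1 (Eventually.of_forall (sp_le α y))

noncomputable def Fm (μ : Measure (Fin d → ℝ)) (α : Finset (Fin k)) (y : Fin k → Fin (d + 1) → ℝ) : ℝ :=
  ∫ x, sp α y x ∂μ

noncomputable def Ph (μ : Measure (Fin d → ℝ)) (α : Finset (Fin k)) (y : Fin k → Fin (d + 1) → ℝ) : ℝ :=
  (∏ i ∈ α, ‖y i‖) * Fm μ α y

theorem Fm_le (μ : Measure (Fin d → ℝ)) [IsFiniteMeasure μ] (α : Finset (Fin k)) (y : Fin k → Fin (d + 1) → ℝ) :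
    ‖Fm μ α y‖ ≤ μ.real Set.univ := by
  have := norm_integral_le_of_norm_le_const (μ := μ) (Eventually.of_forall (sp_le α y))
  simpa [Fm] using this

theorem Ph_cont {μ : Measure (Fin d → ℝ)} (hμ : IsMass μ) (α : Finset (Fin k)) : Continuous (Ph (k := k) μ α) := by
  have := hμ.1
  rw [continuous_iff_continuousAt]
  intro y
  by_cases h : ∀ i ∈ α, y i ≠ 0
  · unfold Ph
    apply ContinuousAt.mul
    · have : Continuous (fun y : Fin k → Fin (d + 1) → ℝ => ∏ i ∈ α, ‖y i‖) := by fun_prop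
      exact this.continuousAt
    · unfold Fm
      apply continuousAt_of_dominated (bound := fun _ => 1)
      · exact Eventually.of_forall fun y => (sp_meas α y).aestronglyMeasurable
      · exact Eventually.of_forall fun y => Eventually.of_forall (sp_le α y)
      · exact integrable_const 1
      · have hae : ∀ᵐ x ∂μ, ∀ i ∈ α, ev (y i) x ≠ 0 := by
          rw [Finset.eventually_all]
          intro i hi
          exact ev_null hμ _ (h i hi)
        filter_upwards [hae] with x hx
        unfold sp
        apply tendsto_finsetProd
        intro i hi
        have c1 : ContinuousAt (fun y : Fin k → Fin (d + 1) → ℝ => ev (y i) x) y :=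
          ((ev_cont_left x).comp (continuous_apply i)).continuousAt
        exact ContinuousAt.comp (f := fun y : Fin k → Fin (d + 1) → ℝ => ev (y i) x) (sign_cont (hx i hi)) c1
  · push Not at h
    obtain ⟨i, hi, h0⟩ := h
    have e0 : ∏ i ∈ α, ‖y i‖ = 0 := Finset.prod_eq_zero hi (by rw [h0, norm_zero])
    have e1 : Ph μ α y = 0 := by unfold Ph; rw [e0, zero_mul]
    unfold ContinuousAt
    rw [e1]
    apply squeeze_zero_norm (a := fun y : Fin k → Fin (d + 1) → ℝ => (∏ i ∈ α, ‖y i‖) * μ.real Set.univ)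
    · intro y
      unfold Ph
      rw [norm_mul, norm_prod]
      simp only [norm_norm]
      exact mul_le_mul_of_nonneg_left (Fm_le μ α y) (Finset.prod_nonneg fun _ _ => norm_nonneg _)
    · have : Continuous (fun y : Fin k → Fin (d + 1) → ℝ => (∏ i ∈ α, ‖y i‖) * μ.real Set.univ) := by fun_prop
      have t := this.tendsto y
      rw [e0, zero_mul] at t
      exact t

theorem Ph_smul (μ : Measure (Fin d → ℝ)) (α : Finset (Fin k)) (g : Gam k) (y : Fin k → Fin (d + 1) → ℝ) :
    Ph μ α (fun i a => (((g i : ℤˣ) : ℤ) : ℝ) * y i a) = (∏ i ∈ α, (((g i : ℤˣ) : ℤ) : ℝ)) * Ph μ α y := by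
  have h1 : ∀ i, ‖fun a => (((g i : ℤˣ) : ℤ) : ℝ) * y i a‖ = ‖y i‖ := by
    intro i
    rcases Int.units_eq_one_or (g i) with h | h
    · rw [h]; simp
    · rw [h]; rw [← norm_neg (y i)]; congr 1; funext a; simp
  have h2 : ∀ x, sp α (fun i a => (((g i : ℤˣ) : ℤ) : ℝ) * y i a) x =
      (∏ i ∈ α, (((g i : ℤˣ) : ℤ) : ℝ)) * sp α y x := by
    intro x
    unfold sp
    rw [← Finset.prod_mul_distrib]
    apply Finset.prod_congr rfl
    intro i _
    have : ev (fun a => (((g i : ℤˣ) : ℤ) : ℝ) * y i a) x = (((g i : ℤˣ) : ℤ) : ℝ) * ev (y i) x := by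
      unfold ev
      rw [mul_add, Finset.mul_sum]
      simp only [mul_assoc]
    rw [this]
    rcases Int.units_eq_one_or (g i) with h | h
    · rw [h]; simp
    · rw [h]; simp [Real.sign_neg]
  unfold Ph Fm
  simp only [h1, h2, integral_const_mul]
  ring

theorem Fm_inv {μ : Measure (Fin d → ℝ)} (hμ : IsMass μ) (y : Fin k → Fin (d + 1) → ℝ) (hy : ∀ i, y i ≠ 0)
    (h : ∀ α : Finset (Fin k), α.Nonempty → Fm μ α y = 0) : Equiparts (fun i => aff (y i)) μ := by
  have := hμ.1
  intro ε
  set O : Set (Fin d → ℝ) := {x | ∀ t, if ε t then 0 < aff (y t) x else aff (y t) x < 0} with hO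
  have hOm : MeasurableSet O := by
    have : O = ⋂ t, {x | if ε t then 0 < aff (y t) x else aff (y t) x < 0} := by
      ext x; simp [hO]
    rw [this]
    apply MeasurableSet.iInter
    intro t
    cases ε t
    · simpa [aff_apply] using measurableSet_lt (ev_cont_right (y t)).measurable measurable_const
    · simpa [aff_apply] using measurableSet_lt measurable_const (ev_cont_right (y t)).measurable
  let c : Fin k → ℝ := fun t => if ε t then 1 else -1
  have hae : ∀ᵐ x ∂μ, ∀ i, ev (y i) x ≠ 0 := by
    rw [ae_all_iff]
    intro i
    exact ev_null hμ _ (hy i)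
  have e1 : ∀ᵐ x ∂μ, O.indicator (fun _ => (2 : ℝ) ^ k) x =
      ∑ α ∈ (Finset.univ : Finset (Fin k)).powerset, (∏ i ∈ α, c i) * sp α y x := by
    filter_upwards [hae] with x hx
    have e2 : ∑ α ∈ (Finset.univ : Finset (Fin k)).powerset, (∏ i ∈ α, c i) * sp α y x =
        ∏ i, (1 + c i * Real.sign (ev (y i) x)) := by
      rw [Finset.prod_one_add]
      apply Finset.sum_congr rfl
      intro α _
      unfold sp
      rw [Finset.prod_mul_distrib]
    rw [e2]
    by_cases hxO : x ∈ O
    · rw [Set.indicator_of_mem hxO]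
      have : ∀ i, 1 + c i * Real.sign (ev (y i) x) = 2 := by
        intro i
        have := hxO i
        simp only [c]
        rw [aff_apply] at this
        cases hε : ε i
        · rw [hε] at this; simp at this; rw [Real.sign_of_neg this]; norm_num
        · rw [hε] at this; simp at this; rw [Real.sign_of_pos this]; norm_num
      simp [this]
    · rw [Set.indicator_of_notMem hxO]
      symm
      simp only [hO, Set.mem_ofPred_eq, not_forall] at hxO
      obtain ⟨i, hi⟩ := hxO
      apply Finset.prod_eq_zero (Finset.mem_univ i)
      simp only [c]
      rw [aff_apply] at hi
      cases hε : ε i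
      · rw [hε] at hi; simp at hi; rw [Real.sign_of_pos (lt_of_le_of_ne hi (hx i).symm)]; norm_num
      · rw [hε] at hi; simp at hi; rw [Real.sign_of_neg (lt_of_le_of_ne hi (hx i))]; norm_num
  have e3 := integral_congr_ae e1
  rw [integral_indicator_const _ hOm, integral_finsetSum _ (fun α _ => (sp_int μ α y).const_mul _)] at e3
  simp only [integral_const_mul] at e3
  rw [Finset.sum_eq_single ∅] at e3
  · simp only [sp, Finset.prod_empty, one_mul, integral_const, smul_eq_mul, mul_one] at e3
    rw [ENNReal.eq_div_iff (by simp) (by simp)]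
    rw [← ENNReal.toReal_eq_toReal_iff' (ENNReal.mul_ne_top (by simp) (measure_ne_top _ _)) (measure_ne_top _ _)]
    rw [ENNReal.toReal_mul]
    simp only [ENNReal.toReal_pow, ENNReal.toReal_ofNat]
    rw [mul_comm]
    exact e3
  · intro α _ hα
    have := h α (Finset.nonempty_iff_ne_empty.2 hα)
    unfold Fm at this
    rw [this, mul_zero]
  · intro h'; simp at h'

theorem aff_ne {μ : Measure (Fin d → ℝ)} (hμ : IsMass μ) (h0 : μ ≠ 0) (y : Fin k → Fin (d + 1) → ℝ)
    (i : Fin k) (hy : y i ≠ 0) (h : Fm μ {i} y = 0) : (aff (y i)).linear ≠ 0 := by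
  have := hμ.1
  intro hl
  have hc := aff_linear _ hl
  have hlast : y i (Fin.last d) ≠ 0 := by
    intro h'
    apply hy
    funext a
    exact Fin.lastCases h' hc a
  have : Fm μ {i} y = μ.real Set.univ * Real.sign (y i (Fin.last d)) := by
    unfold Fm sp ev
    simp [hc]
  rw [this] at h
  rcases mul_eq_zero.1 h with h1 | h1
  · rw [Measure.real, ENNReal.toReal_eq_zero_iff] at h1
    rcases h1 with h1 | h1
    · exact h0 (Measure.measure_univ_eq_zero.1 h1)
    · exact measure_ne_top _ _ h1
  · exact hlast (Real.sign_eq_zero_iff.1 h1)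

end Meas
end GHR

namespace GHR
open Filter Topology

theorem Fm_of_Ph {k d : ℕ} {μ : Measure (Fin d → ℝ)} {α : Finset (Fin k)} {y : Fin k → Fin (d + 1) → ℝ}
    (hy : ∀ i, y i ≠ 0) (h : Ph μ α y = 0) : Fm μ α y = 0 := by
  rcases mul_eq_zero.1 h with h | h
  · exact absurd h (Finset.prod_ne_zero_iff.2 fun i _ => norm_ne_zero_iff.2 (hy i))
  · exact h

theorem core1 (d : ℕ) (hd : 1 ≤ d) (μ : Fin d → Measure (Fin d → ℝ)) (hμ : ∀ m, IsMass (μ m)) :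
    ∃ w : Fin 1 → Fin (d + 1) → ℝ, (∀ i, w i ≠ 0) ∧ ∀ α : Finset (Fin 1), α.Nonempty → ∀ m, Fm (μ m) α w = 0 := by
  obtain ⟨D, rfl⟩ : ∃ D, d = D + 1 := ⟨d - 1, by omega⟩
  obtain ⟨p, hp, h0⟩ := bu_top (k := 1) (N := D + 1 + 1) (δ := fun _ => D + 1) (fun _ => by omega) one_pos D
    (by simp) (fun _ => {0}) (fun m => Ph (μ m) {0}) (fun m => (Ph_cont (hμ m) _).continuousOn)
    (fun m g x _ => Ph_smul (μ m) {0} g x) (by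
      simp only [Finset.sum_singleton, Finset.prod_const, Finset.card_univ, Fintype.card_fin]
      rw [MvPolynomial.coeff_X_pow, if_pos]
      · exact one_ne_zero
      · apply Finsupp.ext
        intro i
        have : i = 0 := Subsingleton.elim _ _
        subst this
        simp)
  have hy : ∀ i, p i ≠ 0 := fun i h => by
    have := (hp i).1
    rw [h, norm_zero] at this
    exact zero_ne_one this
  refine ⟨p, hy, fun α hα m => ?_⟩
  have : α = {0} := by
    obtain ⟨i, hi⟩ := hα
    ext j
    have e1 : i = 0 := Subsingleton.elim _ _
    have e2 : j = 0 := Subsingleton.elim _ _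
    subst e1; subst e2
    simpa using hi
  rw [this]
  exact Fm_of_Ph hy (h0 m)

theorem core2 (K n r d : ℕ) (hr1 : 1 ≤ r) (hr2 : r ≤ 2 ^ n) (hd : d = 2 ^ (n + K + 1) + r)
    (μ : Fin (2 ^ n + r) → Measure (Fin d → ℝ)) (hμ : ∀ m, IsMass (μ m)) (hne : ∀ m, μ m ≠ 0) :
    ∃ w : Fin (K + 2) → Fin (d + 1) → ℝ, (∀ i, w i ≠ 0) ∧
      ∀ α : Finset (Fin (K + 2)), α.Nonempty → ∀ m, Fm (μ m) α w = 0 := by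
  have h2n : 0 < 2 ^ n := by positivity
  have hpow : 2 ^ (n + 1) = 2 * 2 ^ n := by ring
  obtain ⟨N, hN⟩ : ∃ N, N = 2 ^ (n + K + 1) + 2 ^ n + 1 := ⟨_, rfl⟩
  have hdN : d + 1 ≤ N := by omega
  have hδ : ∀ i, dlt K n i < N := by
    intro i
    unfold dlt
    split_ifs with h
    · omega
    · have : 2 ^ (n + i.1) ≤ 2 ^ (n + K + 1) := Nat.pow_le_pow_right (by norm_num) (by omega)
      omega
  let yy : (Fin (K + 2) → Fin N → ℝ) → Fin (K + 2) → Fin (d + 1) → ℝ := fun x i a => x i (Fin.castLE hdN a)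
  have hyy : Continuous yy := by fun_prop
  let idx : Fin (2 ^ (n + 1)) → Fin N := fun m => ⟨2 ^ (n + K + 1) + 1 + (m.1 - 2 ^ n), by have := m.2; omega⟩
  let zz : (Fin (K + 2) → Fin N → ℝ) → ℝ := fun x => ∑ a : Fin N, if d < a.1 then x 0 a * x 1 a else 0
  have hzz : Continuous zz := by
    apply continuous_finsetSum
    intro a _
    split_ifs <;> fun_prop
  let f : Finset (Fin (K + 2)) → Fin (2 ^ (n + 1)) → (Fin (K + 2) → Fin N → ℝ) → ℝ := fun α m x =>
    if hm : m.1 < 2 ^ n + r then Ph (μ ⟨m.1, hm⟩) α (yy x) + (if α = {0, 1} then zz x else 0)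
    else if α.card = 1 then ∏ i ∈ α, x i (idx m) else 0
  have hf : ∀ α m, Continuous (f α m) := by
    intro α m
    simp only [f]
    split_ifs
    · exact ((Ph_cont (hμ _) α).comp hyy).add hzz
    · exact ((Ph_cont (hμ _) α).comp hyy).add continuous_const
    · fun_prop
    · exact continuous_const
  have hg : ∀ α m (g : Gam (K + 2)) (x : Fin (K + 2) → Fin N → ℝ),
      f α m (fun i a => (((g i : ℤˣ) : ℤ) : ℝ) * x i a) = (∏ i ∈ α, (((g i : ℤˣ) : ℤ) : ℝ)) * f α m x := by
    intro α m g x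
    simp only [f]
    have e1 : ∀ h, Ph (μ ⟨m.1, h⟩) α (yy (fun i a => (((g i : ℤˣ) : ℤ) : ℝ) * x i a)) =
      (∏ i ∈ α, (((g i : ℤˣ) : ℤ) : ℝ)) * Ph (μ ⟨m.1, h⟩) α (yy x) := fun h => Ph_smul _ α g (yy x)
    split_ifs with h1 h2 h3
    · rw [e1, mul_add]
      congr 1
      rw [h2, Finset.prod_pair (by simp)]
      simp only [zz, Finset.mul_sum]
      apply Finset.sum_congr rfl
      intro a _
      split_ifs
      · ring
      · simp
    · rw [e1, mul_add, mul_zero]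
    · rw [Finset.prod_mul_distrib]
    · rw [mul_zero]
  have hpts : ∀ (α : Finset (Fin (K + 2))) (h : Fin (K + 2) → ℝ), ∏ i ∈ ts α, h (sw K i) = ∏ i ∈ α, h i := by
    intro α h
    unfold ts
    rw [Finset.prod_map]
    apply Finset.prod_congr rfl
    intro i _
    exact congrArg h (sw_sw i)
  have hτ : ∀ α m (x : Fin (K + 2) → Fin N → ℝ), f (ts α) m (fun i => x (sw K i)) = f α m x := by
    intro α m x
    simp only [f]
    have e1 : ∀ h, Ph (μ ⟨m.1, h⟩) (ts α) (yy (fun i => x (sw K i))) = Ph (μ ⟨m.1, h⟩) α (yy x) := by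
      intro h
      unfold Ph Fm sp
      congr 1
      · exact hpts α (fun i => ‖yy x i‖)
      · congr 1
        funext u
        exact hpts α (fun i => Real.sign (ev (yy x i) u))
    have e2 : (ts α = {0, 1}) ↔ α = {0, 1} := by
      have e3 : ts ({0, 1} : Finset (Fin (K + 2))) = {0, 1} := ts_eq _ (by simp)
      constructor
      · intro h; rw [← ts_ts α, h, e3]
      · rintro rfl; exact e3
    have e4 : (ts α).card = α.card := Finset.card_map _
    have e5 : zz (fun i => x (sw K i)) = zz x := by
      simp only [zz]
      rw [show sw K 0 = 1 from Equiv.swap_apply_left 0 1, show sw K 1 = 0 from Equiv.swap_apply_right 0 1]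
      simp only [mul_comm]
    simp only [e1, e2, e4, e5]
    rw [hpts α (fun i => x i (idx m))]
  let m0 : Fin (2 ^ (n + 1)) := ⟨0, by omega⟩
  let m1 : Fin (2 ^ (n + 1)) := ⟨1, by omega⟩
  have hm1 : m1.1 < 2 ^ n + r := by show 1 < _; omega
  -- a point of `YY` is nonzero in each block
  have hnz : ∀ x ∈ YY N (dlt K n), ∀ i, yy x i = 0 → (∀ a : Fin N, d < a.1 → x i a = 0) → False := by
    intro x hx i h1 h2
    have h3 : x i = 0 := by
      funext a
      by_cases ha : d < a.1
      · exact h2 a ha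
      · have := congrFun h1 ⟨a.1, by omega⟩
        exact this
    have := (hx i).1
    rw [h3, norm_zero] at this
    exact zero_ne_one this
  have hdg0 : ∀ x ∈ YY N (dlt K n), x 0 = x 1 → f {0, 1} m1 x ≠ 0 := by
    intro x hx he hz
    have hfin := (hμ ⟨m1.1, hm1⟩).1
    simp only [f] at hz
    rw [dif_pos hm1, if_pos trivial] at hz
    have hzn : ∀ a : Fin N, 0 ≤ if d < a.1 then x 0 a * x 1 a else 0 := by
      intro a
      rw [he]
      split_ifs
      · exact mul_self_nonneg _
      · exact le_rfl
    have hz1 : 0 ≤ zz x := Finset.sum_nonneg fun a _ => hzn a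
    have hsq : ∀ u, sp {0, 1} (yy x) u = Real.sign (ev (yy x 0) u) * Real.sign (ev (yy x 0) u) := by
      intro u
      unfold sp
      rw [Finset.prod_pair (by simp)]
      have : yy x 1 = yy x 0 := by simp only [yy, he]
      rw [this]
    have hF : 0 ≤ Fm (μ ⟨m1.1, hm1⟩) {0, 1} (yy x) := by
      apply integral_nonneg
      intro u
      simp only [Pi.zero_apply]
      rw [hsq]
      exact mul_self_nonneg _
    have hP : 0 ≤ Ph (μ ⟨m1.1, hm1⟩) {0, 1} (yy x) :=
      mul_nonneg (Finset.prod_nonneg fun _ _ => norm_nonneg _) hF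
    have hP0 : Ph (μ ⟨m1.1, hm1⟩) {0, 1} (yy x) = 0 := by linarith
    have hz0 : zz x = 0 := by linarith
    refine hnz x hx 0 ?_ ?_
    · by_contra hy0
      have hy1 : yy x 1 ≠ 0 := by
        have : yy x 1 = yy x 0 := by simp only [yy, he]
        rwa [this]
      rcases mul_eq_zero.1 hP0 with h | h
      · rw [Finset.prod_pair (by simp)] at h
        rcases mul_eq_zero.1 h with h | h
        · exact hy0 (norm_eq_zero.1 h)
        · exact hy1 (norm_eq_zero.1 h)
      · have e1 : Fm (μ ⟨m1.1, hm1⟩) {0, 1} (yy x) = ∫ u, (1 : ℝ) ∂(μ ⟨m1.1, hm1⟩) := by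
          apply integral_congr_ae
          filter_upwards [ev_null (hμ ⟨m1.1, hm1⟩) _ hy0] with u hu
          rw [hsq]
          rcases Real.sign_apply_eq_of_ne_zero _ hu with h | h <;> rw [h] <;> norm_num
        rw [e1] at h
        simp only [integral_const, smul_eq_mul, mul_one] at h
        rw [Measure.real, ENNReal.toReal_eq_zero_iff] at h
        rcases h with h | h
        · exact hne _ (Measure.measure_univ_eq_zero.1 h)
        · exact measure_ne_top _ _ h
    · intro a ha
      have := (Finset.sum_eq_zero_iff_of_nonneg (fun a _ => hzn a)).1 hz0 a (Finset.mem_univ a)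
      rw [if_pos ha, ← he] at this
      exact mul_self_eq_zero.1 this
  have hdg : ∀ x ∈ YY N (dlt K n), (x 0 = x 1 ∨ x 0 = - x 1) → f {0, 1} m1 x ≠ 0 := by
    intro x hx h hz
    rcases h with h | h
    · exact hdg0 x hx h hz
    · let g : Gam (K + 2) := Function.update 1 1 (-1)
      refine hdg0 (fun i a => (((g i : ℤˣ) : ℤ) : ℝ) * x i a) ?_ ?_ ?_
      · intro i
        refine ⟨?_, fun a ha => ?_⟩
        · rw [← (hx i).1]
          show ‖fun a => (((g i : ℤˣ) : ℤ) : ℝ) * x i a‖ = ‖x i‖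
          rcases Int.units_eq_one_or (g i) with h | h
          · rw [h]; simp
          · rw [h, ← norm_neg (x i)]; congr 1; funext a; simp
        · show (((g i : ℤˣ) : ℤ) : ℝ) * x i a = 0
          rw [(hx i).2 a ha, mul_zero]
      · funext a
        have e0 : g 0 = 1 := by simp [g]
        have e1 : g 1 = -1 := by simp [g]
        show (((g 0 : ℤˣ) : ℤ) : ℝ) * x 0 a = (((g 1 : ℤˣ) : ℤ) : ℝ) * x 1 a
        rw [e0, e1, h]; simp
      · rw [hg, hz, mul_zero]
  obtain ⟨p, hp, h0⟩ := ghr_top hδ f (fun α m => (hf α m).continuousOn) (fun α m g x _ => hg α m g x)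
    (fun α m x _ => hτ α m x) m0 m1 (by simp [m0, m1]) hdg
  have hz : ∀ i, ∀ a : Fin N, d < a.1 → p i a = 0 := by
    intro i a ha
    have ha2 := a.2
    have := h0 {i} (by simp) ⟨a.1 - 2 ^ (n + K + 1) - 1 + 2 ^ n, by omega⟩
    simp only [f] at this
    rw [dif_neg (by omega), if_pos (by simp), Finset.prod_singleton] at this
    rw [← this]
    congr 1
    apply Fin.ext
    simp only [idx]
    omega
  have hy : ∀ i, yy p i ≠ 0 := fun i h => hnz p hp i h (hz i)
  refine ⟨yy p, hy, fun α hα m => ?_⟩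
  have := h0 α hα ⟨m.1, by have := m.2; omega⟩
  simp only [f] at this
  rw [dif_pos m.2] at this
  have hzz0 : zz p = 0 := by
    apply Finset.sum_eq_zero
    intro a _
    split_ifs with h
    · rw [hz 0 a h, zero_mul]
    · rfl
  rw [hzz0] at this
  simp only [ite_self, add_zero] at this
  exact Fm_of_Ph hy this

theorem core (k n r d : ℕ) (hk : 1 ≤ k) (hr1 : 1 ≤ r) (hr2 : r ≤ 2 ^ n) (hd : d = 2 ^ (n + k - 1) + r)
    (μ : Fin (2 ^ n + r) → Measure (Fin d → ℝ)) (hμ : ∀ m, IsMass (μ m)) (hne : ∀ m, μ m ≠ 0) :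
    ∃ w : Fin k → Fin (d + 1) → ℝ, (∀ i, w i ≠ 0) ∧
      ∀ α : Finset (Fin k), α.Nonempty → ∀ m, Fm (μ m) α w = 0 := by
  obtain ⟨K, rfl⟩ : ∃ K, k = K + 1 := ⟨k - 1, by omega⟩
  cases K with
  | zero =>
    have hd' : 2 ^ n + r = d := by rw [hd]; simp
    obtain ⟨w, h1, h2⟩ := core1 d (by omega) (fun m => μ (Fin.cast hd'.symm m)) (fun m => hμ _)
    exact ⟨w, h1, fun α hα m => h2 α hα (Fin.cast hd' m)⟩
  | succ K =>
    exact core2 K n r d hr1 hr2 (by rw [hd]; congr 2) μ hμ hne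

theorem final (k n r d : ℕ) (hk : 1 ≤ k) (hr1 : 1 ≤ r) (hr2 : r ≤ 2 ^ n) (hd : d = 2 ^ (n + k - 1) + r)
    (μ : Fin (2 ^ n + r) → Measure (Fin d → ℝ)) (hμ : ∀ m, IsMass (μ m)) :
    ∃ f : Fin k → ((Fin d → ℝ) →ᵃ[ℝ] ℝ), (∀ t, (f t).linear ≠ 0) ∧ ∀ i, Equiparts f (μ i) := by
  classical
  have hzero : ∀ (f : Fin k → ((Fin d → ℝ) →ᵃ[ℝ] ℝ)) i, μ i = 0 → Equiparts f (μ i) := by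
    intro f i h ε
    rw [h]; simp
  by_cases hall : ∀ m, μ m = 0
  · refine ⟨fun _ => aff (fun _ => 1), fun t h => ?_, fun i => hzero _ i (hall i)⟩
    have := aff_linear _ h (⟨0, by rw [hd]; positivity⟩ : Fin d)
    exact one_ne_zero this
  · push Not at hall
    obtain ⟨j, hj⟩ := hall
    obtain ⟨w, h1, h2⟩ := core k n r d hk hr1 hr2 hd (fun m => if μ m = 0 then μ j else μ m)
      (fun m => by split_ifs; exacts [hμ j, hμ m])
      (fun m => by split_ifs with h; exacts [hj, h])
    refine ⟨fun i => aff (w i), fun t => ?_, fun i => ?_⟩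
    · have := h2 {t} (by simp) j
      rw [if_neg hj] at this
      exact aff_ne (hμ j) hj w t (h1 t) this
    · by_cases hi : μ i = 0
      · exact hzero _ i hi
      · refine Fm_inv (hμ i) w h1 (fun α hα => ?_)
        have := h2 α hα i
        rwa [if_neg hi] at this

end GHR

/-- Grünbaum–Hadwiger–Ramos upper bound: for `j = 2^n + r` with `1 ≤ r ≤ 2^n` and
`d = 2^(n+k-1) + r`, any `j` masses on `ℝ^d` are simultaneously equiparted by some
arrangement of `k` affine hyperplanes. -/
theorem GHR_upper_bound (k n r : ℕ) (hk : 1 ≤ k) (hr1 : 1 ≤ r) (hr2 : r ≤ 2 ^ n)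
    (μ : Fin (2 ^ n + r) → Measure (Fin (2 ^ (n + k - 1) + r) → ℝ))
    (hμ : ∀ i, IsMass (μ i)) :
    ∃ f : Fin k → ((Fin (2 ^ (n + k - 1) + r) → ℝ) →ᵃ[ℝ] ℝ),
      (∀ t, (f t).linear ≠ 0) ∧ ∀ i, Equiparts f (μ i) := by
  exact GHR.final k n r _ hk hr1 hr2 rfl μ hμ
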